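/- Let p be prime, k a field of characteristic p, and λ = rp + a with 0 ≤ a < p and a ≠ p − 1. Then the quotient of the free k[s,t]-module of rank λ+1 by specific relations arising from the projective cover of the Weyl module V(λ) yields: Ω(V(λ)) ≅ V((r+2)p − a − 2) as sl₂-modules, where Ω denotes the Heller shift (kernel of the projective cover). In particular, dim Ω(V(λ)) = (r+2)p − a − 1. -/

import Mathlib

open LieAlgebra.SpecialLinear

variable (k : Type) [Field k]

/-- The restricted Lie algebra `sl₂(k)`. -/
abbrev sl2 := sl (Fin 2) k

/-- A Lie module over `sl₂` is restricted if the `p`-th power of the action of any `x ∈ sl₂`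
is the action of the `p`-th matrix power of `x` (the `p`-operation on `sl₂`). -/
def IsRestricted (p : ℕ) (M : Type) [AddCommGroup M] [Module k M]
    [LieRingModule (sl2 k) M] [LieModule k (sl2 k) M] : Prop :=
  ∀ x y : sl2 k, (x : Matrix (Fin 2) (Fin 2) k) ^ p = (y : Matrix (Fin 2) (Fin 2) k) →
    (LieModule.toEnd k (sl2 k) M x) ^ p = LieModule.toEnd k (sl2 k) M y

/-- `V` is (isomorphic to) the Weyl module `V(μ)`: it has a basis `v₀, …, v_μ` with
`e·v_i = (μ−i+1)·v_{i−1}`, `f·v_i = (i+1)·v_{i+1}`, `h·v_i = (μ−2i)·v_i`. -/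
def IsWeyl (μ : ℕ) (V : Type) [AddCommGroup V] [Module k V]
    [LieRingModule (sl2 k) V] [LieModule k (sl2 k) V] (E F H : sl2 k) : Prop :=
  ∃ v : ℕ → V,
    LinearIndependent k (fun i : Fin (μ + 1) => v (i : ℕ)) ∧
    Submodule.span k (Set.range fun i : Fin (μ + 1) => v (i : ℕ)) = ⊤ ∧
    (∀ j, μ < j → v j = 0) ∧
    ⁅E, v 0⁆ = 0 ∧
    (∀ i : ℕ, ⁅E, v (i + 1)⁆ = ((μ : ℤ) - (i : ℤ)) • v i) ∧
    (∀ i : ℕ, ⁅F, v i⁆ = ((i : ℤ) + 1) • v (i + 1)) ∧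
    (∀ i : ℕ, ⁅H, v i⁆ = ((μ : ℤ) - 2 * (i : ℤ)) • v i)

/-- `P` is projective in the category of restricted `sl₂(k)`-modules. -/
def IsRestrictedProjective (p : ℕ) (P : Type) [AddCommGroup P] [Module k P]
    [LieRingModule (sl2 k) P] [LieModule k (sl2 k) P] : Prop :=
  ∀ (M N : Type) [AddCommGroup M] [Module k M] [LieRingModule (sl2 k) M]
      [LieModule k (sl2 k) M] [AddCommGroup N] [Module k N] [LieRingModule (sl2 k) N]
      [LieModule k (sl2 k) N],
    IsRestricted k p M → IsRestricted k p N →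
    ∀ (g : M →ₗ⁅k,sl2 k⁆ N), Function.Surjective g →
      ∀ f : P →ₗ⁅k,sl2 k⁆ N, ∃ h : P →ₗ⁅k,sl2 k⁆ M, g.comp h = f

open Finset in
theorem sub_pow_pred_of_commute {R : Type*} [Ring R] {p : ℕ} [CharP R p] (hp : p.Prime)
    {x y : R} (hxy : Commute x y) :
    (x - y) ^ (p - 1) = ∑ i ∈ range p, x ^ i * y ^ (p - 1 - i) := by
  have key : ∀ m, m < p → (((p - 1).choose m : ℕ) : R) = (-1) ^ m := by
    intro m
    induction m with
    | zero => simp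
    | succ m ih =>
      intro hm
      have h1 : (((p - 1 + 1).choose (m + 1) : ℕ) : R) = 0 := by
        rw [Nat.sub_add_cancel hp.one_le, CharP.cast_eq_zero_iff R p]
        exact hp.dvd_choose_self (by omega) hm
      rw [Nat.choose_succ_succ, Nat.cast_add, ih (by omega)] at h1
      rw [pow_succ, mul_neg_one, eq_neg_iff_add_eq_zero, add_comm, h1]
  have hpar : ((-1 : R)) ^ (p - 1) = 1 := by
    rw [← key (p - 1) (by have := hp.pos; omega)]; simp
  rw [sub_eq_add_neg, (hxy.neg_right).add_pow, Nat.sub_add_cancel hp.one_le]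
  refine sum_congr rfl fun m hm => ?_
  have hm := mem_range.1 hm
  rw [key m hm, neg_pow y, mul_assoc, mul_assoc,
    ((Commute.neg_one_left (y ^ (p - 1 - m))).pow_left m).symm.eq,
    ← mul_assoc (_ ^ _) (_ ^ m), ← pow_add, Nat.sub_add_cancel (by omega), hpar, one_mul]

open Finset Polynomial in
theorem derivative_pow_eq_sum {R : Type*} [Ring R] (Z : R[X]) (n : ℕ) :
    derivative (Z ^ n) = ∑ i ∈ range n, Z ^ i * derivative Z * Z ^ (n - 1 - i) := by
  induction n with
  | zero => simp
  | succ n ih =>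
    rw [pow_succ, derivative_mul, ih, sum_range_succ, sum_mul]
    congr 1
    · refine sum_congr rfl fun i hi => ?_
      have := mem_range.1 hi
      rw [mul_assoc, ← pow_succ]
      congr 2; omega
    · simp

open Finset Polynomial in
/-- Jacobson's formula: `(x + y)ᵖ - xᵖ - yᵖ` is a Lie polynomial in `x` and `y`. -/
theorem add_pow_sub_mem_of_commutator_mem {k A : Type*} [Field k] [Ring A] [Algebra k A] {p : ℕ}
    [CharP A p] (hp : p.Prime) (S : Submodule k A)
    (hS : ∀ x ∈ S, ∀ y ∈ S, x * y - y * x ∈ S) {x y : A} (hx : x ∈ S) (hy : y ∈ S) :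
    (x + y) ^ p - x ^ p - y ^ p ∈ S := by
  have : Nontrivial A := CharP.nontrivial_of_char_ne_one hp.ne_one
  have : CharP k p := (algebraMap k A).charP_iff (algebraMap k A).injective p |>.2 inferInstance
  have hp1 := hp.two_le
  set Z : A[X] := C x + X * C y with hZ
  have hdZ : derivative Z = C y := by simp [hZ]
  have hcoeff : ∀ n (B : A[X]), (Z * B - B * Z).coeff n =
      (x * B.coeff n - B.coeff n * x) +
        (if n = 0 then 0 else y * B.coeff (n - 1) - B.coeff (n - 1) * y) := by
    intro n B
    have hX : B * (X * C y) = X * (B * C y) := by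
      rw [← mul_assoc, ← X_mul, mul_assoc]
    rw [hZ, add_mul, mul_add, hX, mul_assoc]
    cases n
    · simp
    · simp; abel
  have hlie : ∀ B : A[X], (∀ n, B.coeff n ∈ S) → ∀ n, (Z * B - B * Z).coeff n ∈ S := by
    intro B hB n
    rw [hcoeff]
    refine S.add_mem (hS _ hx _ (hB _)) ?_
    split_ifs
    · exact S.zero_mem
    · exact hS _ hy _ (hB _)
  let Lz := LinearMap.mulLeft ℤ Z
  let Rz := LinearMap.mulRight ℤ Z
  have hiter : ∀ m n, (((Lz - Rz) ^ m) (C y)).coeff n ∈ S := by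
    intro m
    induction m with
    | zero =>
      intro n
      simp only [pow_zero, Module.End.one_apply, coeff_C]
      split_ifs
      · exact hy
      · exact S.zero_mem
    | succ m ih =>
      rw [pow_succ', Module.End.mul_apply]
      exact hlie _ ih
  have : CharP (Module.End ℤ A[X]) p := by
    refine ⟨fun n => ?_⟩
    rw [← CharP.cast_eq_zero_iff A[X] p n]
    constructor
    · intro h
      have := congrArg (fun g : Module.End ℤ A[X] => g 1) h
      simpa [Module.End.natCast_apply] using this
    · intro h
      ext1 g
      rw [Module.End.natCast_apply, nsmul_eq_mul, h]; simp
  have hder : derivative (Z ^ p) = ((Lz - Rz) ^ (p - 1)) (C y) := by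
    rw [derivative_pow_eq_sum, hdZ,
      sub_pow_pred_of_commute hp (LinearMap.commute_mulLeft_right Z Z), LinearMap.sum_apply]
    refine sum_congr rfl fun i _ => ?_
    simp [LinearMap.pow_mulLeft, LinearMap.pow_mulRight, mul_assoc]
  have hmid : ∀ i, i + 1 < p → (Z ^ p).coeff (i + 1) ∈ S := by
    intro i hi
    have h1 := hiter (p - 1) i
    rw [← hder, coeff_derivative] at h1
    have h2 : ((i + 1 : ℕ) : k) ≠ 0 := by
      rw [Ne, CharP.cast_eq_zero_iff k p]
      exact fun h => absurd (Nat.le_of_dvd (Nat.succ_pos _) h) (by omega)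
    have h3 : (Z ^ p).coeff (i + 1) = ((i + 1 : ℕ) : k)⁻¹ •
        ((Z ^ p).coeff (i + 1) * ((i : A) + 1)) := by
      have : ((i : A) + 1) = algebraMap k A ((i + 1 : ℕ) : k) := by simp
      rw [this, ← Algebra.commutes, ← Algebra.smul_def, inv_smul_smul₀ h2]
    rw [h3]
    exact S.smul_mem _ h1
  let ev : A[X] →+* A := eval₂RingHom' (RingHom.id A) 1 (fun a => Commute.one_right a)
  have hev : ev (Z ^ p) = (x + y) ^ p := by
    rw [map_pow]; congr 1; simp [ev, hZ, eval₂RingHom']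
  have hZdeg : (Z ^ p).natDegree ≤ p := by
    refine natDegree_pow_le.trans ?_
    have : Z.natDegree ≤ 1 := by
      rw [hZ, X_mul_C, add_comm]; exact natDegree_linear_le
    nlinarith
  have hsum : (x + y) ^ p = ∑ i ∈ range (p + 1), (Z ^ p).coeff i := by
    rw [← hev]
    change eval₂ _ _ _ = _
    rw [eval₂_eq_sum_range' _ (Nat.lt_succ_of_le hZdeg)]
    simp
  have h0 : (Z ^ p).coeff 0 = x ^ p := by
    rw [coeff_zero_eq_eval_zero]
    let ev0 : A[X] →+* A := eval₂RingHom' (RingHom.id A) 0 (fun a => Commute.zero_right a)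
    have : ev0 (Z ^ p) = x ^ p := by
      rw [map_pow]; congr 1; simp [ev0, hZ, eval₂RingHom', X_mul_C]
    exact this
  have hpc : (Z ^ p).coeff p = y ^ p := by
    have hd : Z.natDegree ≤ 1 := by
      rw [hZ, X_mul_C, add_comm]; exact natDegree_linear_le
    have := coeff_pow_of_natDegree_le (n := 1) (m := p) hd
    rw [mul_one] at this
    rw [this]; simp [hZ]
  obtain ⟨q, rfl⟩ : ∃ q, p = q + 1 := ⟨p - 1, by omega⟩
  have hmem : ∑ i ∈ range q, (Z ^ (q + 1)).coeff (i + 1) ∈ S :=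
    S.sum_mem fun i hi => hmid i (by have := mem_range.1 hi; omega)
  rw [hsum, sum_range_succ, sum_range_succ', h0, hpc]
  convert hmem using 1
  abel

section Representations

attribute [local instance] LieRing.ofAssociativeRing

theorem sl2_eq_combination {E F H : sl2 k}
    (hE : (E : Matrix (Fin 2) (Fin 2) k) = !![0, 1; 0, 0])
    (hF : (F : Matrix (Fin 2) (Fin 2) k) = !![0, 0; 1, 0])
    (hH : (H : Matrix (Fin 2) (Fin 2) k) = !![1, 0; 0, -1]) (x : sl2 k) :
    x = (x : Matrix (Fin 2) (Fin 2) k) 0 1 • E + (x : Matrix (Fin 2) (Fin 2) k) 1 0 • F +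
      (x : Matrix (Fin 2) (Fin 2) k) 0 0 • H := by
  have htr : (x : Matrix (Fin 2) (Fin 2) k) 0 0 + (x : Matrix (Fin 2) (Fin 2) k) 1 1 = 0 := by
    have h : Matrix.trace (x : Matrix (Fin 2) (Fin 2) k) = 0 := x.2
    rwa [Matrix.trace_fin_two] at h
  apply Subtype.ext
  change _ = _ • (E : Matrix (Fin 2) (Fin 2) k) + _ • (F : Matrix (Fin 2) (Fin 2) k) +
    _ • (H : Matrix (Fin 2) (Fin 2) k)
  rw [hE, hF, hH]
  ext i j
  fin_cases i <;> fin_cases j <;> simp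
  linear_combination htr

theorem sl2_basis_pow {p : ℕ} [CharP k p] (hp : p.Prime) {E F H : sl2 k}
    (hE : (E : Matrix (Fin 2) (Fin 2) k) = !![0, 1; 0, 0])
    (hF : (F : Matrix (Fin 2) (Fin 2) k) = !![0, 0; 1, 0])
    (hH : (H : Matrix (Fin 2) (Fin 2) k) = !![1, 0; 0, -1]) :
    (E : Matrix (Fin 2) (Fin 2) k) ^ p = 0 ∧ (F : Matrix (Fin 2) (Fin 2) k) ^ p = 0 ∧
      (H : Matrix (Fin 2) (Fin 2) k) ^ p = H := by
  have hneg : (-1 : k) ^ p = -1 := by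
    have : Fact p.Prime := ⟨hp⟩
    simpa [hp.ne_zero] using sub_pow_char_of_commute (p := p) (Commute.zero_left (1 : k))
  have hEsq : (!![0, 1; 0, 0] : Matrix (Fin 2) (Fin 2) k) ^ 2 = 0 := by
    ext i j; fin_cases i <;> fin_cases j <;> simp [pow_two]
  have hFsq : (!![0, 0; 1, 0] : Matrix (Fin 2) (Fin 2) k) ^ 2 = 0 := by
    ext i j; fin_cases i <;> fin_cases j <;> simp [pow_two]
  have hd : (!![1, 0; 0, -1] : Matrix (Fin 2) (Fin 2) k) = Matrix.diagonal ![1, -1] := by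
    ext i j; fin_cases i <;> fin_cases j <;> rfl
  rw [hE, hF, hH]
  refine ⟨pow_eq_zero_of_le hp.two_le hEsq, pow_eq_zero_of_le hp.two_le hFsq, ?_⟩
  rw [hd, Matrix.diagonal_pow]
  congr 1
  ext i; fin_cases i <;> simp [hneg]

/-- A module on which the standard basis of `sl₂` satisfies the restrictedness condition is
restricted. -/
theorem isRestricted_of_basis {p : ℕ} [CharP k p] (hp : p.Prime) {E F H : sl2 k}
    (hE : (E : Matrix (Fin 2) (Fin 2) k) = !![0, 1; 0, 0])
    (hF : (F : Matrix (Fin 2) (Fin 2) k) = !![0, 0; 1, 0])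
    (hH : (H : Matrix (Fin 2) (Fin 2) k) = !![1, 0; 0, -1])
    (M : Type) [AddCommGroup M] [Module k M] [LieRingModule (sl2 k) M] [LieModule k (sl2 k) M]
    (hEp : LieModule.toEnd k (sl2 k) M E ^ p = 0) (hFp : LieModule.toEnd k (sl2 k) M F ^ p = 0)
    (hHp : LieModule.toEnd k (sl2 k) M H ^ p = LieModule.toEnd k (sl2 k) M H) :
    IsRestricted k p M := by
  let A := Matrix (Fin 2) (Fin 2) k × Module.End k M
  have hA : CharP A p := by
    have : CharP (Matrix (Fin 2) (Fin 2) k) p := inferInstance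
    refine ⟨fun n => ?_⟩
    constructor
    · intro h
      exact (CharP.cast_eq_zero_iff (Matrix (Fin 2) (Fin 2) k) p n).1 (congrArg Prod.fst h)
    · intro h
      have hk : (n : k) = 0 := (CharP.cast_eq_zero_iff k p n).2 h
      have : algebraMap k A (n : k) = 0 := by rw [hk, map_zero]
      rwa [map_natCast] at this
  let σ : sl2 k →ₗ[k] A :=
    (sl2 k).toSubmodule.subtype.prod (LieModule.toEnd k (sl2 k) M : sl2 k →ₗ[k] Module.End k M)
  have hσ : ∀ x y, σ x * σ y - σ y * σ x = σ ⁅x, y⁆ := by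
    intro x y
    refine Prod.ext rfl ?_
    change LieModule.toEnd k (sl2 k) M x * LieModule.toEnd k (sl2 k) M y -
      LieModule.toEnd k (sl2 k) M y * LieModule.toEnd k (sl2 k) M x =
      LieModule.toEnd k (sl2 k) M ⁅x, y⁆
    rw [LieHom.map_lie]; rfl
  have hS : ∀ u ∈ LinearMap.range σ, ∀ v ∈ LinearMap.range σ,
      u * v - v * u ∈ LinearMap.range σ := by
    rintro _ ⟨x, rfl⟩ _ ⟨y, rfl⟩
    exact ⟨⁅x, y⁆, (hσ x y).symm⟩
  have hadd : ∀ x y, σ x ^ p ∈ LinearMap.range σ → σ y ^ p ∈ LinearMap.range σ →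
      σ (x + y) ^ p ∈ LinearMap.range σ := by
    intro x y hx hy
    have h := add_pow_sub_mem_of_commutator_mem hp (LinearMap.range σ) hS ⟨x, rfl⟩ ⟨y, rfl⟩
    have h2 := Submodule.add_mem _ (Submodule.add_mem _ h hy) hx
    rw [map_add]
    convert h2 using 1
    abel
  have hsmul : ∀ (c : k) x, σ x ^ p ∈ LinearMap.range σ → σ (c • x) ^ p ∈ LinearMap.range σ := by
    intro c x hx
    rw [map_smul, smul_pow]
    exact Submodule.smul_mem _ _ hx
  obtain ⟨hEpow, hFpow, hHpow⟩ := sl2_basis_pow k hp hE hF hH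
  have hEm : σ E ^ p ∈ LinearMap.range σ :=
    ⟨0, by rw [map_zero]; exact Prod.ext hEpow.symm hEp.symm⟩
  have hFm : σ F ^ p ∈ LinearMap.range σ :=
    ⟨0, by rw [map_zero]; exact Prod.ext hFpow.symm hFp.symm⟩
  have hHm : σ H ^ p ∈ LinearMap.range σ := ⟨H, Prod.ext hHpow.symm hHp.symm⟩
  have hall : ∀ x, σ x ^ p ∈ LinearMap.range σ := by
    intro x
    rw [sl2_eq_combination k hE hF hH x]
    exact hadd _ _ (hadd _ _ (hsmul _ _ hEm) (hsmul _ _ hFm)) (hsmul _ _ hHm)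
  intro x y hxy
  obtain ⟨z, hz⟩ := hall x
  have h1 : (z : Matrix (Fin 2) (Fin 2) k) = (x : Matrix (Fin 2) (Fin 2) k) ^ p :=
    congrArg Prod.fst hz
  have h2 : LieModule.toEnd k (sl2 k) M z = LieModule.toEnd k (sl2 k) M x ^ p :=
    congrArg Prod.snd hz
  have : z = y := Subtype.ext (h1.trans hxy)
  rw [← h2, this]

/-- The representation of `sl₂` given by operators satisfying the `sl₂`-relations. -/
noncomputable def sl2Rep {Q : Type} [AddCommGroup Q] [Module k Q] (e f h : Module.End k Q)
    (hef : e * f - f * e = h) (hhe : h * e - e * h = (2 : k) • e)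
    (hhf : h * f - f * h = -((2 : k) • f)) : sl2 k →ₗ⁅k⁆ Module.End k Q where
  toFun x := (x : Matrix (Fin 2) (Fin 2) k) 0 1 • e + (x : Matrix (Fin 2) (Fin 2) k) 1 0 • f +
      (x : Matrix (Fin 2) (Fin 2) k) 0 0 • h
  map_add' x y := by
    simp [add_smul]; abel
  map_smul' c x := by
    simp [mul_smul]
  map_lie' := by
    intro x y
    have htr : ∀ x : sl2 k,
      (x : Matrix (Fin 2) (Fin 2) k) 1 1 = - (x : Matrix (Fin 2) (Fin 2) k) 0 0 := by
      intro x
      have h : Matrix.trace (x : Matrix (Fin 2) (Fin 2) k) = 0 := x.2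
      rw [Matrix.trace_fin_two] at h
      linear_combination h
    have hx := htr x
    have hy := htr y
    have h1 : ((⁅x, y⁆ : sl2 k) : Matrix (Fin 2) (Fin 2) k) = (x : Matrix (Fin 2) (Fin 2) k) * y -
      (y : Matrix (Fin 2) (Fin 2) k) * x := rfl
    rw [h1]
    change _ = _ * _ - _ * _
    have r1 : e * f = f * e + h := by rw [← hef]; abel
    have r2 : h * e = e * h + (2 : k) • e := by rw [← hhe]; abel
    have r3 : h * f = f * h - (2 : k) • f := by rw [sub_eq_add_neg, ← hhf]; abel
    simp only [Matrix.sub_apply, Matrix.mul_apply, Fin.sum_univ_two, hx, hy, add_mul, mul_add,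
      smul_mul_assoc, mul_smul_comm, r1, r2, r3]
    module

/-- Lifting along a surjection from a restricted module given by operators. -/
theorem IsRestrictedProjective.exists_lift {p : ℕ} [CharP k p] (hp : p.Prime) {E F H : sl2 k}
    (hE : (E : Matrix (Fin 2) (Fin 2) k) = !![0, 1; 0, 0])
    (hF : (F : Matrix (Fin 2) (Fin 2) k) = !![0, 0; 1, 0])
    (hH : (H : Matrix (Fin 2) (Fin 2) k) = !![1, 0; 0, -1])
    {V P : Type} [AddCommGroup V] [Module k V] [LieRingModule (sl2 k) V]
    [LieModule k (sl2 k) V] [AddCommGroup P] [Module k P] [LieRingModule (sl2 k) P]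
    [LieModule k (sl2 k) P] (hVres : IsRestricted k p V) (hPproj : IsRestrictedProjective k p P)
    (π : P →ₗ⁅k,sl2 k⁆ V) {Q : Type} [AddCommGroup Q] [Module k Q] {e f h : Module.End k Q}
    (hef : e * f - f * e = h) (hhe : h * e - e * h = (2 : k) • e)
    (hhf : h * f - f * h = -((2 : k) • f)) (hep : e ^ p = 0) (hfp : f ^ p = 0) (hhp : h ^ p = h)
    (τ : Q →ₗ[k] V) (hτ : Function.Surjective τ) (hτe : ∀ q, τ (e q) = ⁅E, τ q⁆)
    (hτf : ∀ q, τ (f q) = ⁅F, τ q⁆) (hτh : ∀ q, τ (h q) = ⁅H, τ q⁆) :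
    ∃ φ : P →ₗ[k] Q, (∀ x, τ (φ x) = π x) ∧ (∀ x, φ ⁅E, x⁆ = e (φ x)) ∧
      (∀ x, φ ⁅F, x⁆ = f (φ x)) ∧ ∀ x, φ ⁅H, x⁆ = h (φ x) := by
  let ρ := sl2Rep k e f h hef hhe hhf
  let _ : LieRingModule (sl2 k) Q := LieRingModule.compLieHom Q ρ
  have _ : LieModule k (sl2 k) Q := LieModule.compLieHom Q ρ
  have hρ : ∀ (x : sl2 k) (q : Q), ⁅x, q⁆ = ρ x q := fun _ _ => rfl
  have hρE : ρ E = e := by simp [ρ, sl2Rep, hE]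
  have hρF : ρ F = f := by simp [ρ, sl2Rep, hF]
  have hρH : ρ H = h := by simp [ρ, sl2Rep, hH]
  have hend : ∀ x : sl2 k, LieModule.toEnd k (sl2 k) Q x = ρ x := fun _ => rfl
  have hQ : IsRestricted k p Q := by
    apply isRestricted_of_basis k hp hE hF hH
    · rw [hend, hρE, hep]
    · rw [hend, hρF, hfp]
    · rw [hend, hρH, hhp]
  let g : Q →ₗ⁅k,sl2 k⁆ V :=
    { τ with
      map_lie' := by
        intro x q
        change τ ⁅x, q⁆ = ⁅x, τ q⁆
        rw [sl2_eq_combination k hE hF hH x]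
        simp only [add_lie, smul_lie, map_add, map_smul, hρ, hρE, hρF, hρH]
        simp only [LinearMap.add_apply, LinearMap.smul_apply, map_add, map_smul, hτe, hτf, hτh] }
  obtain ⟨φ, hφ⟩ := hPproj Q V hQ hVres g hτ π
  refine ⟨φ, fun x => ?_, fun x => ?_, fun x => ?_, fun x => ?_⟩
  · rw [← hφ]; rfl
  · exact (LieModuleHom.map_lie φ E x).trans (by rw [hρ, hρE]; rfl)
  · exact (LieModuleHom.map_lie φ F x).trans (by rw [hρ, hρF]; rfl)
  · exact (LieModuleHom.map_lie φ H x).trans (by rw [hρ, hρH]; rfl)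

end Representations

/-- Operators `e, f, h` defining a restricted representation of `sl₂`. -/
structure RestrictedOperators (p : ℕ) {M : Type} [AddCommGroup M] [Module k M]
    (e f h : Module.End k M) : Prop where
  ef : e * f - f * e = h
  he : h * e - e * h = (2 : k) • e
  hf : h * f - f * h = -((2 : k) • f)
  e_pow : e ^ p = 0
  f_pow : f ^ p = 0
  h_pow : h ^ p = h

namespace RestrictedOperators

variable {k}
variable {p : ℕ} {M : Type} [AddCommGroup M] [Module k M] {e f h : Module.End k M}

theorem e_f_apply (R : RestrictedOperators k p e f h) (x : M) : e (f x) = f (e x) + h x := by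
  rw [← R.ef]; simp

theorem h_e_apply (R : RestrictedOperators k p e f h) (x : M) :
    h (e x) = e (h x) + (2 : k) • e x := by
  have := congrArg (fun g : Module.End k M => g x) R.he
  simp only [LinearMap.sub_apply, Module.End.mul_apply, LinearMap.smul_apply] at this
  rw [← this]; abel

theorem h_f_apply (R : RestrictedOperators k p e f h) (x : M) :
    h (f x) = f (h x) - (2 : k) • f x := by
  have := congrArg (fun g : Module.End k M => g x) R.hf
  simp only [LinearMap.sub_apply, Module.End.mul_apply, LinearMap.smul_apply,
    LinearMap.neg_apply] at this
  rw [sub_eq_add_neg, ← this]; abel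

variable {α : k} {x : M}

theorem h_e_pow (R : RestrictedOperators k p e f h) (hx : h x = α • x) (n : ℕ) :
    h ((e ^ n) x) = (α + 2 * n) • (e ^ n) x := by
  induction n with
  | zero => simp [hx]
  | succ n ih =>
    rw [pow_succ', Module.End.mul_apply, R.h_e_apply, ih, map_smul]
    push_cast; module

theorem h_f_pow (R : RestrictedOperators k p e f h) (hx : h x = α • x) (n : ℕ) :
    h ((f ^ n) x) = (α - 2 * n) • (f ^ n) x := by
  induction n with
  | zero => simp [hx]
  | succ n ih =>
    rw [pow_succ', Module.End.mul_apply, R.h_f_apply, ih, map_smul]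
    push_cast; module

theorem h_f_e (R : RestrictedOperators k p e f h) (hx : h x = α • x) :
    h (f (e x)) = α • f (e x) := by
  rw [R.h_f_apply, R.h_e_apply, hx]
  simp only [map_add, map_smul]; module

theorem f_e_pow_succ (R : RestrictedOperators k p e f h) (hx : h x = α • x) (n : ℕ) :
    f ((e ^ (n + 1)) x) = (e ^ n) (f (e x)) - (n * (α + n + 1) : k) • (e ^ n) x := by
  induction n with
  | zero => simp
  | succ n ih =>
    have h1 : f (e ((e ^ (n + 1)) x)) = e (f ((e ^ (n + 1)) x)) - h ((e ^ (n + 1)) x) := by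
      rw [R.e_f_apply]; abel
    rw [pow_succ', Module.End.mul_apply, h1, ih, R.h_e_pow hx, map_sub, map_smul,
      ← Module.End.mul_apply e, ← Module.End.mul_apply e, ← pow_succ']
    push_cast; module

theorem e_f_pow_succ (R : RestrictedOperators k p e f h) (hx : h x = α • x) (n : ℕ) :
    e ((f ^ (n + 1)) x) = (f ^ (n + 1)) (e x) + ((n + 1) * (α - n) : k) • (f ^ n) x := by
  induction n with
  | zero => simp [R.e_f_apply, hx]
  | succ n ih =>
    rw [pow_succ' f (n + 1), Module.End.mul_apply, R.e_f_apply, ih, R.h_f_pow hx, map_add, map_smul,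
      ← Module.End.mul_apply f, ← Module.End.mul_apply f, ← pow_succ', ← pow_succ']
    push_cast; module

open Polynomial in
theorem h_aeval (R : RestrictedOperators k p e f h) (hx : h x = α • x) (q : k[X]) :
    h (aeval (f * e) q x) = α • aeval (f * e) q x := by
  induction q using Polynomial.induction_on generalizing x with
  | C c => rw [aeval_C, Module.algebraMap_end_apply, map_smul, hx, smul_comm]
  | add q r hq hr => simp [hq hx, hr hx]
  | monomial n c ih =>
    rw [pow_succ, ← mul_assoc, map_mul, Module.End.mul_apply, aeval_X]
    exact ih (R.h_f_e hx)

open Polynomial Finset in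
theorem f_pow_e_pow_succ (R : RestrictedOperators k p e f h) (hx : h x = α • x) (n : ℕ) :
    (f ^ n) ((e ^ (n + 1)) x) =
      e (aeval (f * e) (∏ j ∈ Icc 1 n, (X - C (j * (α + j + 1) : k))) x) := by
  induction n generalizing x with
  | zero => simp
  | succ n ih =>
    have hx' : h (f (e x) - ((n + 1 : ℕ) * (α + (n + 1 : ℕ) + 1) : k) • x) =
        α • (f (e x) - ((n + 1 : ℕ) * (α + (n + 1 : ℕ) + 1) : k) • x) := by
      rw [map_sub, map_smul, R.h_f_e hx, hx]; module
    rw [pow_succ f, Module.End.mul_apply, R.f_e_pow_succ hx,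
      ← map_smul (e ^ (n + 1)), ← map_sub, ih hx', prod_Icc_succ_top (by omega), map_mul,
      Module.End.mul_apply]
    rw [map_sub (aeval (f * e) : k[X] →ₐ[k] Module.End k M), aeval_X, aeval_C, LinearMap.sub_apply,
      Module.algebraMap_end_apply, Module.End.mul_apply]

end RestrictedOperators

theorem natCast_ne_zero_of_lt {k : Type} [Field k] {p : ℕ} [CharP k p] {n : ℕ} (h0 : n ≠ 0)
    (hn : n < p) : (n : k) ≠ 0 := by
  rw [Ne, CharP.cast_eq_zero_iff k p]
  exact fun h => absurd (Nat.le_of_dvd (Nat.pos_of_ne_zero h0) h) (by omega)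

namespace RestrictedOperators

variable {k}
variable {p : ℕ} {M : Type} [AddCommGroup M] [Module k M] {e f h : Module.End k M}

open Polynomial Finset in
/-- Over a restricted module, a vector of weight `a ≠ p - 1` killed by `f e` lifts to a vector of
the same weight killed by `e f e`. -/
theorem exists_lift_weight_vector [CharP k p] (hp : p.Prime) {a c : ℕ} (hac : a + c + 1 = p)
    (hc : c ≠ 0) (R : RestrictedOperators k p e f h) {V : Type} [AddCommGroup V] [Module k V]
    {e' f' h' : Module.End k V} (π : M →ₗ[k] V) (hπ : Function.Surjective π)
    (he : ∀ x, π (e x) = e' (π x)) (hf : ∀ x, π (f x) = f' (π x)) (hh : ∀ x, π (h x) = h' (π x))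
    {v : V} (hv : h' v = (a : k) • v) (hfe : f' (e' v) = 0) :
    ∃ x, π x = v ∧ h x = (a : k) • x ∧ e (f (e x)) = 0 := by
  have : Fact p.Prime := ⟨hp⟩
  have hp0 : (p : k) = 0 := CharP.cast_eq_zero k p
  have hac' : (a : k) + c + 1 = 0 := by rw [← hp0, ← hac]; push_cast; ring
  -- weight projection
  obtain ⟨z, hz⟩ := hπ v
  set D : Module.End k M := h - algebraMap k _ (a : k) with hD
  have hDp : D ^ p = D := by
    have : CharP (Module.End k M)  p ∨ Subsingleton M := by
      rcases subsingleton_or_nontrivial M with hM | hM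
      · exact Or.inr hM
      · exact Or.inl (charP_of_injective_algebraMap (algebraMap k _).injective p)
    rcases this with hM | hM
    · rw [hD, sub_pow_char_of_commute (p := p) (Algebra.commute_algebraMap_right _ _), R.h_pow,
        ← map_pow]
      congr 2
      have h1 := congrArg (ZMod.castHom (dvd_refl p) k) (ZMod.pow_card (a : ZMod p))
      rwa [map_pow, map_natCast] at h1
    · ext y; exact Subsingleton.elim _ _
  have hDapply : ∀ y, D y = h y - (a : k) • y := fun y => by
    rw [hD, LinearMap.sub_apply, Module.algebraMap_end_apply]
  have hDv : ∀ n y, π y = v → π ((D ^ (n + 1)) y) = 0 := by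
    intro n
    induction n with
    | zero => intro y hy; rw [zero_add, pow_one, hDapply, map_sub, map_smul, hh, hy, hv, sub_self]
    | succ n ih =>
      intro y hy
      rw [pow_succ', Module.End.mul_apply]
      rw [hDapply, map_sub, map_smul, hh, ih y hy, map_zero, smul_zero, sub_zero]
  obtain ⟨m, rfl⟩ : ∃ m, p = m + 2 := ⟨p - 2, by have := hp.two_le; omega⟩
  set w := z - (D ^ (m + 1)) z with hw
  have hπw : π w = v := by rw [hw, map_sub, hDv m z hz, hz, sub_zero]
  have hhw : h w = (a : k) • w := by
    have h1 : D w = 0 := by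
      rw [hw, map_sub, ← Module.End.mul_apply D, ← pow_succ', hDp, sub_self]
    rw [hDapply] at h1
    exact sub_eq_zero.1 h1
  -- remove the zero root
  set r : ℕ → k := fun j => j * ((a : k) + j + 1) with hr
  set q : k[X] := ∏ j ∈ (Icc 1 (m + 1)).erase c, (X - C (r j)) with hq
  have hcmem : c ∈ Icc 1 (m + 1) := by rw [mem_Icc]; omega
  have hprod : ∏ j ∈ Icc 1 (m + 1), (X - C (r j)) = X * q := by
    rw [← mul_prod_erase _ _ hcmem]
    congr 1
    have : r c = 0 := by simp only [hr]; rw [hac', mul_zero]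
    rw [this, C_0, sub_zero]
  have hkill : e (f (e (aeval (f * e) q w))) = 0 := by
    have h1 := R.f_pow_e_pow_succ hhw (m + 1)
    rw [R.e_pow, LinearMap.zero_apply, map_zero] at h1
    change 0 = e (aeval (f * e) (∏ j ∈ Icc 1 (m + 1), (X - C (r j))) w) at h1
    rw [hprod, map_mul, aeval_X, Module.End.mul_apply, Module.End.mul_apply] at h1
    exact h1.symm
  have hq0 : q.eval 0 ≠ 0 := by
    rw [hq, eval_prod, prod_ne_zero_iff]
    intro j hj
    rw [mem_erase, mem_Icc] at hj
    simp only [hr, eval_sub, eval_X, eval_C, zero_sub, neg_ne_zero]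
    refine mul_ne_zero (natCast_ne_zero_of_lt (p := m + 2) (by omega) (by omega)) fun h0 => ?_
    have h1 : ((a + j + 1 : ℕ) : k) = 0 := by push_cast; exact h0
    rw [CharP.cast_eq_zero_iff k (m + 2)] at h1
    obtain ⟨t, ht⟩ := h1
    have : t = 1 := by
      rcases t with _ | _ | t
      · omega
      · rfl
      · nlinarith
    subst this
    omega
  have hπq : ∀ g : k[X], ∀ y, f' (e' (π y)) = 0 → π (aeval (f * e) g y) = g.eval 0 • π y := by
    intro g
    induction g using Polynomial.induction_on' with
    | add g₁ g₂ h₁ h₂ => intro y hy; simp [h₁ y hy, h₂ y hy, add_smul]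
    | monomial n s =>
      intro y hy
      rw [aeval_monomial, Module.End.mul_apply, Module.algebraMap_end_apply, map_smul]
      cases n with
      | zero => simp
      | succ n =>
        have : ∀ n, π (((f * e) ^ (n + 1)) y) = 0 := by
          intro n
          induction n with
          | zero => simp [he, hf, hy]
          | succ n ih =>
            rw [pow_succ', Module.End.mul_apply, Module.End.mul_apply, hf, he, ih]; simp
        rw [this]; simp
  refine ⟨(q.eval 0)⁻¹ • aeval (f * e) q w, ?_, ?_, ?_⟩
  · rw [map_smul, hπq q w (by rw [hπw, hfe]), inv_smul_smul₀ hq0, hπw]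
  · rw [map_smul, R.h_aeval hhw, smul_comm]
  · simp only [map_smul, hkill, smul_zero]

section Span

variable [CharP k p] {a c : ℕ} {x : M}

theorem e_pow_apply_eq_zero (R : RestrictedOperators k p e f h)
    (hac : a + c + 1 = p) (hx : h x = (a : k) • x) (hefe : e (f (e x)) = 0) {n : ℕ}
    (hn : c < n) : (e ^ n) x = 0 := by
  have hdown : ∀ d, c + d < p → (e ^ (p - d)) x = 0 := by
    intro d
    induction d with
    | zero => intro _; rw [Nat.sub_zero, R.e_pow]; rfl
    | succ d ih =>
      intro hd
      obtain ⟨m, hm⟩ : ∃ m, p - (d + 1) = m + 1 := ⟨p - (d + 2), by omega⟩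
      have h1 := R.f_e_pow_succ hx (m + 1)
      have hz := ih (by omega)
      rw [show p - d = m + 1 + 1 by omega] at hz
      rw [hz, map_zero, pow_succ e m, Module.End.mul_apply, Module.End.mul_apply, hefe, map_zero,
        zero_sub, eq_comm, neg_eq_zero, smul_eq_zero] at h1
      rw [hm, pow_succ, Module.End.mul_apply]
      refine h1.resolve_left (mul_ne_zero (natCast_ne_zero_of_lt (p := p) (by omega) (by omega)) ?_)
      have h2 : (a : k) + (m + 1 : ℕ) + 1 = ((m + 1 - c : ℕ) : k) := by
        rw [Nat.cast_sub (by omega), ← sub_eq_zero]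
        have hp0 : (p : k) = 0 := CharP.cast_eq_zero k p
        rw [← hp0, ← hac]; push_cast; ring
      rw [h2]
      exact natCast_ne_zero_of_lt (p := p) (by omega) (by omega)
  by_cases h : n < p
  · have := hdown (p - n) (by omega)
    rwa [Nat.sub_sub_self (by omega)] at this
  · rw [← Nat.sub_add_cancel (not_lt.1 h), pow_add, R.e_pow, mul_zero]; rfl

theorem f_pow_apply_eq_zero (hp : p.Prime) (R : RestrictedOperators k p e f h)
    (hap : a + 1 < p) (hx : h x = (a : k) • x) (hefe : e (f (e x)) = 0) {n : ℕ}
    (hn : a < n) : (f ^ n) (f (e x)) = 0 := by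
  have hy := R.h_f_e hx
  have htop : (f ^ (p - 1)) (f (e x)) = 0 := by
    rw [← Module.End.mul_apply, ← pow_succ, Nat.sub_add_cancel hp.one_le, R.f_pow]; rfl
  have hdown : ∀ d, a + d + 1 < p → (f ^ (p - 1 - d)) (f (e x)) = 0 := by
    intro d
    induction d with
    | zero => intro _; exact htop
    | succ d ih =>
      intro hd
      obtain ⟨m, hm⟩ : ∃ m, p - 1 - (d + 1) = m := ⟨_, rfl⟩
      have h1 := R.e_f_pow_succ hy m
      have hz := ih (by omega)
      rw [show p - 1 - d = m + 1 by omega] at hz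
      rw [hz, map_zero, hefe, map_zero, zero_add, eq_comm, smul_eq_zero] at h1
      rw [hm]
      refine h1.resolve_left (mul_ne_zero ?_ ?_)
      · exact_mod_cast natCast_ne_zero_of_lt (k := k) (p := p) (n := m + 1) (by omega) (by omega)
      · rw [← neg_sub, ← Nat.cast_sub (by omega), neg_ne_zero]
        exact natCast_ne_zero_of_lt (p := p) (by omega) (by omega)
  by_cases h : n < p
  · have := hdown (p - 1 - n) (by omega)
    rwa [Nat.sub_sub_self (by omega)] at this
  · rw [← Nat.sub_add_cancel (not_lt.1 h), pow_add, R.f_pow, mul_zero]; rfl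

/-- A spanning family of the submodule generated by `x`. -/
def spanningFamily (p a c : ℕ) (e f : Module.End k M) (x : M) :
    Fin p ⊕ Fin c ⊕ Fin (a + 1) → M :=
  Sum.elim (fun i => (f ^ (i : ℕ)) x)
    (Sum.elim (fun i => (e ^ ((i : ℕ) + 1)) x) (fun i => (f ^ (i : ℕ)) (f (e x))))

theorem span_spanningFamily_stable (hp : p.Prime) (R : RestrictedOperators k p e f h)
    (hac : a + c + 1 = p) (hc : c ≠ 0) (hx : h x = (a : k) • x) (hefe : e (f (e x)) = 0) {y : M}
    (hy : y ∈ Submodule.span k (Set.range (spanningFamily p a c e f x))) :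
    e y ∈ Submodule.span k (Set.range (spanningFamily p a c e f x)) ∧
    f y ∈ Submodule.span k (Set.range (spanningFamily p a c e f x)) := by
  set U := Submodule.span k (Set.range (spanningFamily p a c e f x))
  have h1 : ∀ i, (f ^ i) x ∈ U := by
    intro i
    by_cases hi : i < p
    · exact Submodule.subset_span ⟨Sum.inl ⟨i, hi⟩, rfl⟩
    · rw [← Nat.sub_add_cancel (not_lt.1 hi), pow_add, R.f_pow, mul_zero]; exact U.zero_mem
  have h2 : ∀ i, (e ^ i) x ∈ U := by
    intro i
    rcases i with _ | i
    · exact h1 0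
    by_cases hi : i < c
    · exact Submodule.subset_span ⟨Sum.inr (Sum.inl ⟨i, hi⟩), rfl⟩
    · rw [R.e_pow_apply_eq_zero hac hx hefe (by omega)]; exact U.zero_mem
  have h3 : ∀ i, (f ^ i) (f (e x)) ∈ U := by
    intro i
    by_cases hi : i < a + 1
    · exact Submodule.subset_span ⟨Sum.inr (Sum.inr ⟨i, hi⟩), rfl⟩
    · rw [R.f_pow_apply_eq_zero hp (by omega) hx hefe (by omega)]; exact U.zero_mem
  induction hy using Submodule.span_induction with
  | zero => simp
  | add y z _ _ hy hz => rw [map_add, map_add]; exact ⟨U.add_mem hy.1 hz.1, U.add_mem hy.2 hz.2⟩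
  | smul s y _ hy => rw [map_smul, map_smul]; exact ⟨U.smul_mem _ hy.1, U.smul_mem _ hy.2⟩
  | mem y hy =>
    obtain ⟨i | i | i, rfl⟩ := hy
    · change e ((f ^ (i : ℕ)) x) ∈ U ∧ f ((f ^ (i : ℕ)) x) ∈ U
      constructor
      · obtain ⟨i, hi⟩ := i
        rcases i with _ | i
        · exact h2 1
        · rw [R.e_f_pow_succ hx, pow_succ, Module.End.mul_apply]
          exact U.add_mem (h3 _) (U.smul_mem _ (h1 _))
      · rw [← Module.End.mul_apply, ← pow_succ']; exact h1 _
    · change e ((e ^ ((i : ℕ) + 1)) x) ∈ U ∧ f ((e ^ ((i : ℕ) + 1)) x) ∈ U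
      constructor
      · rw [← Module.End.mul_apply, ← pow_succ']; exact h2 _
      · rw [R.f_e_pow_succ hx]
        refine U.sub_mem ?_ (U.smul_mem _ (h2 _))
        rcases (i : ℕ) with _ | j
        · exact h3 0
        · rw [pow_succ, Module.End.mul_apply, hefe, map_zero]; exact U.zero_mem
    · change e ((f ^ (i : ℕ)) (f (e x))) ∈ U ∧ f ((f ^ (i : ℕ)) (f (e x))) ∈ U
      constructor
      · rcases (i : ℕ) with _ | j
        · simp only [pow_zero, Module.End.one_apply, hefe]; exact U.zero_mem
        · rw [R.e_f_pow_succ (R.h_f_e hx), hefe, map_zero, zero_add]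
          exact U.smul_mem _ (h3 _)
      · rw [← Module.End.mul_apply, ← pow_succ']; exact h3 _

end Span

end RestrictedOperators

/-- `v 0, …, v μ` is a standard basis of a Weyl module for the operators `e, f, h`. -/
structure IsWeylChain (μ : ℕ) {V : Type} [AddCommGroup V] [Module k V]
    (e f h : Module.End k V) (v : ℕ → V) : Prop where
  linearIndependent : LinearIndependent k (fun i : Fin (μ + 1) => v (i : ℕ))
  span_eq_top : Submodule.span k (Set.range fun i : Fin (μ + 1) => v (i : ℕ)) = ⊤
  eq_zero : ∀ j, μ < j → v j = 0
  e_zero : e (v 0) = 0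
  e_succ : ∀ i, e (v (i + 1)) = ((μ : k) - i) • v i
  f_apply : ∀ i, f (v i) = ((i : k) + 1) • v (i + 1)
  h_apply : ∀ i, h (v i) = ((μ : k) - 2 * i) • v i

namespace IsWeylChain

variable {k}
variable {V W : Type} [AddCommGroup V] [Module k V] [AddCommGroup W] [Module k W]
  {μ : ℕ} {e f h : Module.End k V} {v : ℕ → V}

theorem finrank_eq (hv : IsWeylChain k μ e f h v) : Module.finrank k V = μ + 1 := by
  rw [Module.finrank_eq_card_basis (Module.Basis.mk hv.linearIndependent hv.span_eq_top.ge),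
    Fintype.card_fin]

theorem finite (hv : IsWeylChain k μ e f h v) : Module.Finite k V :=
  Module.Finite.of_basis (Module.Basis.mk hv.linearIndependent hv.span_eq_top.ge)

theorem eq_top (hv : IsWeylChain k μ e f h v) {S : Submodule k V} (hS : ∀ i ≤ μ, v i ∈ S) :
    S = ⊤ := by
  rw [← top_le_iff, ← hv.span_eq_top, Submodule.span_le]
  rintro _ ⟨i, rfl⟩
  exact hS _ (by omega)

theorem exists_linearMap (hv : IsWeylChain k μ e f h v) (g : ℕ → W) :
    ∃ A : V →ₗ[k] W, ∀ i ≤ μ, A (v i) = g i := by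
  refine ⟨(Module.Basis.mk hv.linearIndependent hv.span_eq_top.ge).constr k
    fun i : Fin (μ + 1) => g i, fun i hi => ?_⟩
  have := (Module.Basis.mk hv.linearIndependent hv.span_eq_top.ge).constr_basis k
    (fun i : Fin (μ + 1) => g i) ⟨i, by omega⟩
  rwa [Module.Basis.mk_apply] at this

theorem prod_ext (hv : IsWeylChain k μ e f h v) {N : Type} [AddCommGroup N] [Module k N]
    {g g' : V × W →ₗ[k] N} (h1 : ∀ i ≤ μ, g (v i, 0) = g' (v i, 0))
    (h2 : ∀ x, g (0, x) = g' (0, x)) : g = g' := by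
  refine LinearMap.prod_ext (LinearMap.ext_on_range hv.span_eq_top fun i => ?_)
    (LinearMap.ext fun x => h2 x)
  exact h1 i (by omega)

end IsWeylChain

/-- The coefficient `(i + 1) ⋯ (i + d)` in `k`. -/
def ascCoeff (d i : ℕ) : k := ((i + 1).ascFactorial d : ℕ)

section Coefficients

variable {k}

theorem succ_mul_ascCoeff_succ (d i : ℕ) :
    ((i : k) + 1) * ascCoeff k d (i + 1) = ((i : k) + d + 1) * ascCoeff k d i := by
  have h := Nat.succ_ascFactorial (i + 1) d
  unfold ascCoeff
  have h2 := congrArg (Nat.cast (R := k)) h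
  push_cast at h2
  linear_combination h2

variable {p : ℕ} [CharP k p]

theorem ascCoeff_eq_zero {d i j n : ℕ} (hn : 0 < n) (hnd : n ≤ d) (hi : i + n = j * p) :
    ascCoeff k d i = 0 := by
  unfold ascCoeff
  rw [CharP.cast_eq_zero_iff k p]
  refine dvd_trans ⟨j, ?_⟩ (?_ : i + n ∣ _)
  · rw [hi, mul_comm]
  · obtain ⟨n, rfl⟩ := Nat.exists_eq_add_of_le' hn
    obtain ⟨d, rfl⟩ := Nat.exists_eq_add_of_le hnd
    rw [← Nat.ascFactorial_mul_ascFactorial, Nat.ascFactorial_succ]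
    rw [show i + (n + 1) = i + 1 + n by omega]
    exact Dvd.dvd.mul_right (Nat.dvd_mul_right _ _) _

theorem ascCoeff_mul_char (d j : ℕ) : ascCoeff k d (j * p) = (d.factorial : k) := by
  unfold ascCoeff
  induction d with
  | zero => simp
  | succ d ih =>
    rw [Nat.ascFactorial_succ, Nat.factorial_succ]
    push_cast
    rw [ih, CharP.cast_eq_zero k p]
    ring

theorem ascCoeff_ne_zero (hp : p.Prime) {d i j : ℕ} (h1 : j * p ≤ i) (h2 : i + d < j * p + p) :
    ascCoeff k d i ≠ 0 := by
  unfold ascCoeff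
  rw [Ne, CharP.cast_eq_zero_iff k p]
  induction d with
  | zero => simp [hp.one_lt.ne']
  | succ d ih =>
    rw [Nat.ascFactorial_succ, hp.dvd_mul, not_or]
    refine ⟨fun ⟨t, ht⟩ => ?_, ih (by omega)⟩
    have h3 : j < t := by
      by_contra! hle
      have := Nat.mul_le_mul_left p hle
      nlinarith
    have h4 : t < j + 1 := by
      by_contra! hle
      have := Nat.mul_le_mul_left p hle
      nlinarith
    omega

end Coefficients

section Extension

variable {k}

theorem pow_mul_eq_of_commutator {A : Type} [Ring A] {e f h : A} (hef : e * f - f * e = h)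
    (hhe : h * e - e * h = 2 * e) (n : ℕ) :
    e ^ (n + 1) * f = f * e ^ (n + 1) + (n + 1) * (e ^ n * h + n * e ^ n) := by
  have hef' : e * f = f * e + h := by rw [← hef]; abel
  have hhe' : h * e = e * h + 2 * e := by rw [← hhe]; abel
  induction n with
  | zero => simp [hef']
  | succ n ih =>
    have hc : e ^ n * (n : A) = n * e ^ n := (Nat.cast_commute n _).symm
    rw [pow_succ e (n + 1), mul_assoc, hef', mul_add, ← mul_assoc, ih]
    have h1 : (f * e ^ (n + 1) + (n + 1) * (e ^ n * h + n * e ^ n)) * e =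
        f * (e ^ (n + 1) * e) + (n + 1) * (e ^ n * (h * e) + n * (e ^ n * e)) := by
      noncomm_ring
    have h2 : e ^ n * (e * h + 2 * e) = e ^ n * e * h + 2 * (e ^ n * e) := by
      have : e ^ n * 2 = 2 * e ^ n := (Nat.cast_commute 2 _).symm
      rw [mul_add, ← mul_assoc, ← mul_assoc, this, mul_assoc 2]
    rw [h1, hhe', h2, ← pow_succ]
    push_cast
    noncomm_ring

theorem pow_char_commute {p : ℕ} [CharP k p] (hp : p.Prime) {M : Type} [AddCommGroup M]
    [Module k M] {e f h : Module.End k M} (hef : e * f - f * e = h)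
    (hhe : h * e - e * h = (2 : k) • e) (x : M) : (e ^ p) (f x) = f ((e ^ p) x) := by
  obtain ⟨n, rfl⟩ : ∃ n, p = n + 1 := ⟨p - 1, by have := hp.pos; omega⟩
  have h2 : (2 : k) • e = 2 * e := by
    ext y; simp [two_smul, two_mul]
  have h0 : ((n : Module.End k M) + 1) = 0 := by
    ext y
    have : ((n : k) + 1) = 0 := by exact_mod_cast CharP.cast_eq_zero k (n + 1)
    have h3 := congrArg (fun t : k => t • y) this
    simpa [add_smul, Module.End.natCast_apply, Nat.cast_smul_eq_nsmul] using h3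
  have h1 := pow_mul_eq_of_commutator hef (hhe.trans h2) n
  rw [h0, zero_mul, add_zero] at h1
  exact congrArg (fun g : Module.End k M => g x) h1

variable {V W : Type} [AddCommGroup V] [Module k V] [AddCommGroup W] [Module k W]

/-- `e, f` on `V × W` are the operators of the extension of the Weyl module `V` by the Weyl module
`W` given on the standard bases by the coefficients `ascCoeff`. -/
structure IsExtension (μ d : ℕ) (eV fV : Module.End k V) (eW fW : Module.End k W)
    (v : ℕ → V) (w : ℕ → W) (e f : Module.End k (V × W)) : Prop where
  e_fst : ∀ q, (e q).1 = eV q.1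
  f_fst : ∀ q, (f q).1 = fV q.1
  e_inr : ∀ x, e (0, x) = (0, eW x)
  f_inr : ∀ x, f (0, x) = (0, fW x)
  e_inl : ∀ i ≤ μ, e (v i, 0) = (eV (v i), ascCoeff k d i • w (i + d))
  f_inl : ∀ i < μ, f (v i, 0) = (fV (v i), 0)
  f_inl_top : f (v μ, 0) = (0, -(ascCoeff k d (μ + 1) • w (μ + d + 2)))

theorem IsWeylChain.exists_isExtension {μ d : ℕ} {eV fV hV : Module.End k V}
    {eW fW : Module.End k W} {v : ℕ → V} {w : ℕ → W}
    (HV : IsWeylChain k μ eV fV hV v) :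
    ∃ e f : Module.End k (V × W), IsExtension μ d eV fV eW fW v w e f := by
  obtain ⟨A, hA⟩ := HV.exists_linearMap fun i => ascCoeff k d i • w (i + d)
  obtain ⟨B, hB⟩ := HV.exists_linearMap fun i =>
    if i = μ then -(ascCoeff k d (μ + 1) • w (μ + d + 2)) else 0
  refine ⟨(eV ∘ₗ LinearMap.fst k V W).prod (eW ∘ₗ LinearMap.snd k V W + A ∘ₗ LinearMap.fst k V W),
    (fV ∘ₗ LinearMap.fst k V W).prod (fW ∘ₗ LinearMap.snd k V W + B ∘ₗ LinearMap.fst k V W),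
    fun _ => rfl, fun _ => rfl, fun x => ?_, fun x => ?_, fun i hi => ?_, fun i hi => ?_, ?_⟩
  · simp
  · simp
  · simp [hA i hi]
  · simp [hB i hi.le, hi.ne]
  · simp [hB μ le_rfl, HV.f_apply, HV.eq_zero]

theorem map_prodMk (g : Module.End k (V × W)) (x : V) (y : W) : g (x, y) = g (x, 0) + g (0, y) := by
  rw [← map_add, Prod.mk_add_mk, add_zero, zero_add]

theorem prodMk_smul_apply (g : Module.End k (V × W)) (s : k) (x : V) (y : W) :
    g (s • x, y) = s • g (x, 0) + g (0, y) := by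
  rw [map_prodMk, ← map_smul, Prod.smul_mk, smul_zero]

namespace IsExtension

variable {p r a d μ ν : ℕ} {eV fV hV : Module.End k V} {eW fW hW : Module.End k W}
  {v : ℕ → V} {w : ℕ → W} {e f : Module.End k (V × W)}

theorem e_inl_zero (HV : IsWeylChain k μ eV fV hV v) (hQ : IsExtension μ d eV fV eW fW v w e f) :
    e (v 0, 0) = (0, ascCoeff k d 0 • w d) := by
  rw [hQ.e_inl _ (Nat.zero_le _), HV.e_zero, Nat.zero_add]

theorem e_inl_succ (HV : IsWeylChain k μ eV fV hV v) (hQ : IsExtension μ d eV fV eW fW v w e f)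
    {i : ℕ} (hi : i + 1 ≤ μ) :
    e (v (i + 1), 0) = (((μ : k) - i) • v i, ascCoeff k d (i + 1) • w (i + 1 + d)) := by
  rw [hQ.e_inl _ hi, HV.e_succ]

theorem f_inl_of_lt (HV : IsWeylChain k μ eV fV hV v) (hQ : IsExtension μ d eV fV eW fW v w e f)
    {i : ℕ} (hi : i < μ) : f (v i, 0) = ((i : k) + 1) • (v (i + 1), (0 : W)) := by
  rw [hQ.f_inl _ hi, HV.f_apply, Prod.smul_mk, smul_zero]

theorem commutator_e_f (HV : IsWeylChain k μ eV fV hV v) (HW : IsWeylChain k ν eW fW hW w)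
    (hQ : IsExtension μ d eV fV eW fW v w e f) (hν : (ν : k) = d)
    (hV' : eV * fV - fV * eV = hV) (hW' : eW * fW - fW * eW = hW) :
    e * f - f * e = hV.prodMap hW := by
  refine HV.prod_ext (fun i hi => ?_) (fun x => ?_)
  · refine Prod.ext (by rw [← hV']; simp [hQ.e_fst, hQ.f_fst]) ?_
    have hfe : (f (eV (v i), 0)).2 = 0 := by
      rcases i with _ | i
      · simp [HV.e_zero, hQ.f_inr]
      · rw [HV.e_succ, prodMk_smul_apply, hQ.f_inl_of_lt HV (by omega), hQ.f_inr]
        simp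
    have hrec := succ_mul_ascCoeff_succ (k := k) d i
    rw [LinearMap.sub_apply, Module.End.mul_apply, Module.End.mul_apply, hQ.e_inl i hi,
      ← add_zero (eV (v i)), ← zero_add (_ • w _), ← Prod.mk_add_mk, map_add, hQ.f_inr,
      map_smul, HW.f_apply]
    simp only [Prod.snd_sub, Prod.snd_add, hfe, zero_add, LinearMap.prodMap_apply, map_zero]
    rcases hi.lt_or_eq with hi | rfl
    · rw [hQ.f_inl_of_lt HV hi, map_smul, hQ.e_inl_succ HV (by omega), Prod.smul_snd, smul_smul,
        smul_smul, hrec, show i + 1 + d = i + d + 1 by omega]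
      push_cast
      module
    · rw [hQ.f_inl_top, hQ.e_inr, map_neg, map_smul, HW.e_succ, hν, smul_smul, smul_smul,
        ← neg_smul, ← sub_smul]
      convert zero_smul k _ using 2
      push_cast
      linear_combination hrec
  · rw [← hW']
    simp [hQ.e_inr, hQ.f_inr]

theorem commutator_h_e (HV : IsWeylChain k μ eV fV hV v) (HW : IsWeylChain k ν eW fW hW w)
    (hQ : IsExtension μ d eV fV eW fW v w e f) (hν : (ν : k) = d) (hμ : (μ : k) + d + 2 = 0)
    (hV' : hV * eV - eV * hV = (2 : k) • eV) (hW' : hW * eW - eW * hW = (2 : k) • eW) :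
    hV.prodMap hW * e - e * hV.prodMap hW = (2 : k) • e := by
  refine HV.prod_ext (fun i hi => ?_) (fun x => ?_)
  · refine Prod.ext ?_ ?_
    · have := congrArg (fun g : Module.End k V => g (v i)) hV'
      simpa [hQ.e_fst] using this
    · rw [LinearMap.sub_apply, Module.End.mul_apply, Module.End.mul_apply, LinearMap.prodMap_apply,
        LinearMap.prodMap_apply, LinearMap.smul_apply, HV.h_apply, map_zero, prodMk_smul_apply,
        hQ.e_inl i hi, hQ.e_inr]
      simp only [Prod.snd_sub, Prod.snd_add, Prod.smul_snd, map_smul, map_zero, add_zero,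
        HW.h_apply, smul_smul, ← sub_smul, hν]
      congr 1
      push_cast
      linear_combination -hμ * ascCoeff k d i
  · have := congrArg (fun g : Module.End k W => ((0 : V), g x)) hW'
    simpa [hQ.e_inr] using this

theorem commutator_h_f (HV : IsWeylChain k μ eV fV hV v) (HW : IsWeylChain k ν eW fW hW w)
    (hQ : IsExtension μ d eV fV eW fW v w e f) (hν : (ν : k) = d) (hμ : (μ : k) + d + 2 = 0)
    (hV' : hV * fV - fV * hV = -((2 : k) • fV)) (hW' : hW * fW - fW * hW = -((2 : k) • fW)) :
    hV.prodMap hW * f - f * hV.prodMap hW = -((2 : k) • f) := by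
  refine HV.prod_ext (fun i hi => ?_) (fun x => ?_)
  · refine Prod.ext ?_ ?_
    · have := congrArg (fun g : Module.End k V => g (v i)) hV'
      simpa [hQ.f_fst] using this
    · rw [LinearMap.sub_apply, Module.End.mul_apply, Module.End.mul_apply, LinearMap.prodMap_apply,
        LinearMap.prodMap_apply, LinearMap.neg_apply, LinearMap.smul_apply, HV.h_apply, map_zero,
        prodMk_smul_apply, hQ.f_inr]
      rcases hi.lt_or_eq with hi | rfl
      · simp [hQ.f_inl i hi]
      · rw [hQ.f_inl_top]
        simp only [Prod.snd_sub, Prod.snd_add, Prod.smul_snd, map_smul, map_zero, add_zero,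
          HW.h_apply, smul_smul, ← neg_smul, ← sub_smul, hν]
        congr 1
        push_cast
        linear_combination hμ * ascCoeff k d (i + 1)
  · have := congrArg (fun g : Module.End k W => ((0 : V), g x)) hW'
    simpa [hQ.f_inr] using this

theorem pow_inr {g : Module.End k (V × W)} {g' : Module.End k W}
    (hg : ∀ x, g (0, x) = (0, g' x)) (n : ℕ) (x : W) : (g ^ n) (0, x) = (0, (g' ^ n) x) := by
  induction n with
  | zero => rfl
  | succ n ih => rw [pow_succ', pow_succ', Module.End.mul_apply, ih, hg, Module.End.mul_apply]

theorem exists_f_pow_inl (HV : IsWeylChain k μ eV fV hV v)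
    (hQ : IsExtension μ d eV fV eW fW v w e f) (i n : ℕ) (hi : i + n ≤ μ) :
    ∃ s : k, (f ^ n) (v i, 0) = s • (v (i + n), 0) := by
  induction n with
  | zero => exact ⟨1, by simp⟩
  | succ n ih =>
    obtain ⟨s, hs⟩ := ih (by omega)
    refine ⟨s * ((i + n : ℕ) + 1), ?_⟩
    rw [pow_succ', Module.End.mul_apply, hs, map_smul, hQ.f_inl_of_lt HV (by omega), smul_smul,
      add_assoc]

end IsExtension

theorem IsWeylChain.exists_f_pow {μ : ℕ} {e f h : Module.End k V} {v : ℕ → V}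
    (HV : IsWeylChain k μ e f h v) (i n : ℕ) : ∃ s : k, (f ^ n) (v i) = s • v (i + n) := by
  induction n with
  | zero => exact ⟨1, by simp⟩
  | succ n ih =>
    obtain ⟨s, hs⟩ := ih
    refine ⟨s * ((i + n : ℕ) + 1), ?_⟩
    rw [pow_succ', Module.End.mul_apply, hs, map_smul, HV.f_apply, smul_smul, add_assoc]

theorem IsWeylChain.e_pow_succ_eq_zero {μ : ℕ} {e f h : Module.End k V} {v : ℕ → V}
    (HV : IsWeylChain k μ e f h v) {i n : ℕ} (hin : i ≤ n) : (e ^ (n + 1)) (v i) = 0 := by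
  induction n generalizing i with
  | zero => rw [Nat.le_zero.1 hin, zero_add, pow_one, HV.e_zero]
  | succ n ih =>
    rcases i with _ | i
    · rw [pow_succ, Module.End.mul_apply, HV.e_zero, map_zero]
    · rw [pow_succ, Module.End.mul_apply, HV.e_succ, map_smul, ih (by omega), smul_zero]

namespace IsExtension

variable {p r a d μ ν : ℕ} {eV fV hV : Module.End k V} {eW fW hW : Module.End k W}
  {v : ℕ → V} {w : ℕ → W} {e f : Module.End k (V × W)}

theorem f_pow_char [CharP k p] (hp : p.Prime) (hμ : μ = r * p + a) (hν : ν = (r + 1) * p + d)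
    (had : a + d + 2 = p)
    (HV : IsWeylChain k μ eV fV hV v) (HW : IsWeylChain k ν eW fW hW w)
    (hQ : IsExtension μ d eV fV eW fW v w e f) (hW' : fW ^ p = 0) : f ^ p = 0 := by
  refine HV.prod_ext (fun i hi => ?_) (fun x => ?_)
  · by_cases hj : (i / p + 1) * p ≤ μ
    · obtain ⟨n, hn⟩ : ∃ n, i + n + 1 = (i / p + 1) * p :=
        ⟨p - 1 - i % p, by
          have h1 := Nat.div_add_mod' i p
          have h2 := Nat.mod_lt i hp.pos
          rw [add_mul]; omega⟩
      obtain ⟨s, hs⟩ := hQ.exists_f_pow_inl HV i n (by omega)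
      have hz : (f ^ (n + 1)) (v i, 0) = 0 := by
        have h0 : ((i + n : ℕ) + 1 : k) = 0 := by
          rw [← Nat.cast_succ, Nat.succ_eq_add_one, hn]; simp
        rw [pow_succ', Module.End.mul_apply, hs, map_smul, hQ.f_inl_of_lt HV (by omega), h0,
          zero_smul, smul_zero]
      have hnp : n + 1 ≤ p := by
        have h1 := Nat.div_add_mod' i p
        rw [add_mul] at hn
        omega
      rw [← Nat.sub_add_cancel hnp, pow_add, Module.End.mul_apply, hz, map_zero]; rfl
    · have hir : r * p ≤ i := by
        have h1 : r < i / p + 1 := by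
          by_contra! hle
          have := Nat.mul_le_mul_right p hle
          omega
        exact (Nat.le_div_iff_mul_le hp.pos).1 (by omega)
      obtain ⟨n, rfl⟩ := Nat.exists_eq_add_of_le hi
      obtain ⟨s, hs⟩ := hQ.exists_f_pow_inl HV i n le_rfl
      obtain ⟨m, hm⟩ : ∃ m, p = m + (n + 1) := ⟨p - (n + 1), by omega⟩
      obtain ⟨t, ht⟩ := HW.exists_f_pow (i + n + d + 2) m
      have hbig : ν < i + n + d + 2 + m := by
        rw [hν, add_mul]
        omega
      have h2 : (f ^ p) (v i, 0) = 0 := by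
        rw [hm, pow_add, pow_succ', Module.End.mul_apply, Module.End.mul_apply, hs, map_smul,
          hQ.f_inl_top, map_smul, pow_inr hQ.f_inr, map_neg, map_smul, ht, HW.eq_zero _ hbig]
        simp
      rw [h2]; rfl
  · rw [pow_inr hQ.f_inr, hW']; rfl

end IsExtension

theorem ascCoeff_eq_descFactorial {i n N : ℕ} (hi : (i : k) + 1 + N = 0) (hn : n ≤ N) :
    ascCoeff k n i = (-1) ^ n * (N.descFactorial n : k) := by
  unfold ascCoeff
  induction n with
  | zero => simp
  | succ n ih =>
    have hN : ((N - n : ℕ) : k) = N - n := Nat.cast_sub (by omega)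
    rw [Nat.ascFactorial_succ, Nat.descFactorial_succ]
    push_cast
    rw [ih (by omega), hN]
    linear_combination (-1) ^ n * (N.descFactorial n : k) * hi

namespace IsExtension

variable {p r a d μ ν : ℕ} {eV fV hV : Module.End k V} {eW fW hW : Module.End k W}
  {v : ℕ → V} {w : ℕ → W} {e f : Module.End k (V × W)}

theorem e_prodMk_smul (hQ : IsExtension μ d eV fV eW fW v w e f) (s t : k) (x : V) (y : W) :
    e (s • x, t • y) = s • e (x, 0) + (0, t • eW y) := by
  rw [prodMk_smul_apply, hQ.e_inr, map_smul]

theorem e_pow_succ_inl [CharP k p] (hμ : μ = r * p + a) (hν : ν = (r + 1) * p + d)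
    (had : a + d + 2 = p) (HV : IsWeylChain k μ eV fV hV v) (HW : IsWeylChain k ν eW fW hW w)
    (hQ : IsExtension μ d eV fV eW fW v w e f) {j n i : ℕ} (hj : j < r) (hni : n + i = d) :
    (e ^ (n + 1)) (v (j * p + p), 0) =
      (((-1) ^ (n + 1) * ((d + 1).descFactorial (n + 1) : k)) • v (j * p + a + 1 + i),
        ((n.factorial : k) * d.factorial) • w (j * p + p + i)) := by
  have hp0 : (p : k) = 0 := CharP.cast_eq_zero k p
  have hle : j * p + p ≤ r * p := by
    rw [← Nat.succ_mul]; exact Nat.mul_le_mul_right p hj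
  have hμk : (μ : k) = a := by rw [hμ]; push_cast; rw [hp0]; ring
  have hνk : (ν : k) = d := by rw [hν]; push_cast; rw [hp0]; ring
  have hadk : (a : k) + d + 2 = 0 := by rw [← hp0, ← had]; push_cast; ring
  induction n generalizing i with
  | zero =>
    obtain rfl : i = d := by omega
    have h1 := hQ.e_inl_succ HV (i := j * p + a + 1 + i) (by omega)
    rw [show j * p + a + 1 + i + 1 = j * p + p by omega] at h1
    rw [zero_add, pow_one, h1, show j * p + p = (j + 1) * p by ring, ascCoeff_mul_char, hμk]
    congr 2
    · push_cast; rw [hp0, Nat.descFactorial_one]; push_cast; ring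
    · simp
  | succ n ih =>
    have h1 := hQ.e_inl_succ HV (i := j * p + a + 1 + i) (by omega)
    rw [ascCoeff_eq_zero (j := j + 1) (n := n + 1) (p := p) (by omega) (by omega)
      (by rw [add_mul]; omega), zero_smul] at h1
    rw [pow_succ', Module.End.mul_apply, ih (i := i + 1) (by omega), e_prodMk_smul hQ,
      ← add_assoc, h1, ← add_assoc, HW.e_succ, hμk, hνk, Prod.smul_mk, smul_zero, Prod.mk_add_mk,
      add_zero, zero_add, smul_smul, smul_smul]
    have hdn : (d : k) = n + 1 + i := by rw [← hni]; push_cast; ring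
    congr 2
    · rw [Nat.descFactorial_succ _ (n + 1), show d + 1 - (n + 1) = i + 1 by omega]
      push_cast; rw [hp0]; ring
    · rw [Nat.factorial_succ]
      push_cast; rw [hp0, hdn]; ring

theorem e_pow_inl_mul_char [CharP k p] (hμ : μ = r * p + a) (hν : ν = (r + 1) * p + d)
    (had : a + d + 2 = p) (HV : IsWeylChain k μ eV fV hV v) (HW : IsWeylChain k ν eW fW hW w)
    (hQ : IsExtension μ d eV fV eW fW v w e f) {j : ℕ} (hj : j ≤ r) :
    (e ^ (d + 2)) (v (j * p), 0) = 0 := by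
  have hp0 : (p : k) = 0 := CharP.cast_eq_zero k p
  have hμk : (μ : k) = a := by rw [hμ]; push_cast; rw [hp0]; ring
  have hνk : (ν : k) = d := by rw [hν]; push_cast; rw [hp0]; ring
  have hadk : (a : k) + d + 2 = 0 := by rw [← hp0, ← had]; push_cast; ring
  rcases j with _ | j
  · rw [zero_mul, pow_succ, Module.End.mul_apply, hQ.e_inl_zero HV, pow_inr hQ.e_inr, map_smul,
      HW.e_pow_succ_eq_zero le_rfl, smul_zero]; rfl
  · have hle : j * p + p ≤ r * p := by
      rw [← Nat.succ_mul]; exact Nat.mul_le_mul_right p hj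
    have h1 := hQ.e_inl_succ HV (i := j * p + a) (by omega)
    have h2 := HW.e_succ (j * p + a + 1 + d)
    rw [show j * p + a + 1 + d + 1 = j * p + p by omega] at h2
    have h3 : ascCoeff k d (j * p + a + 1) = (-1) ^ d * (d.factorial : k) := by
      rw [ascCoeff_eq_descFactorial (N := d) ?_ le_rfl, Nat.descFactorial_self]
      push_cast; rw [hp0]; linear_combination hadk
    rw [h3] at h1
    rw [Nat.succ_mul, pow_succ', Module.End.mul_apply,
      e_pow_succ_inl hμ hν had HV HW hQ (n := d) (i := 0) hj (add_zero d), e_prodMk_smul hQ,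
      add_zero, add_zero, h1, h2, hμk, hνk, Nat.descFactorial_self, Nat.factorial_succ]
    refine Prod.ext ?_ ?_
    · simp only [Prod.fst_add, Prod.smul_fst, smul_smul, add_zero, Prod.fst_zero]
      convert zero_smul k _ using 2
      push_cast; rw [hp0]; ring
    · simp only [Prod.snd_add, Prod.smul_snd, smul_smul, Prod.snd_zero, ← add_smul]
      convert zero_smul k _ using 2
      have hsq : (-1 : k) ^ d * (-1) ^ d = 1 := by rw [← mul_pow]; simp
      push_cast; rw [hp0, pow_succ]
      linear_combination (-(d.factorial : k) ^ 2 * (d + 1)) * hsq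
        - (d.factorial : k) ^ 2 * hadk

theorem e_pow_char [CharP k p] (hμ : μ = r * p + a) (hν : ν = (r + 1) * p + d)
    (had : a + d + 2 = p) (HV : IsWeylChain k μ eV fV hV v) (HW : IsWeylChain k ν eW fW hW w)
    (hQ : IsExtension μ d eV fV eW fW v w e f) (hW' : eW ^ p = 0)
    (hcomm : ∀ q, (e ^ p) (f q) = f ((e ^ p) q)) : e ^ p = 0 := by
  refine HV.prod_ext (fun i hi => ?_) (fun x => ?_)
  · rw [LinearMap.zero_apply]
    have hmul : ∀ j ≤ r, (e ^ p) (v (j * p), 0) = 0 := fun j hj => by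
      rw [show e ^ p = e ^ a * e ^ (d + 2) by rw [← pow_add, ← add_assoc, had],
        Module.End.mul_apply, e_pow_inl_mul_char hμ hν had HV HW hQ hj, map_zero]
    induction i with
    | zero => simpa using hmul 0 (Nat.zero_le r)
    | succ i ih =>
      by_cases hdvd : p ∣ i + 1
      · obtain ⟨j, hj⟩ := hdvd
        rw [hj, mul_comm]
        refine hmul j ?_
        by_contra! hlt
        have := Nat.mul_le_mul_left p hlt
        rw [Nat.succ_eq_add_one, mul_add, mul_comm p r] at this
        omega
      · have h1 : ((i : k) + 1) ≠ 0 := by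
          rw [← Nat.cast_succ, Ne, CharP.cast_eq_zero_iff k p]; exact hdvd
        have h2 := hcomm (v i, 0)
        rw [ih (by omega), map_zero, hQ.f_inl_of_lt HV (by omega), map_smul, smul_eq_zero] at h2
        exact h2.resolve_left h1
  · rw [pow_inr hQ.e_inr, hW']; rfl

theorem restrictedOperators [CharP k p] (hp : p.Prime) (hμ : μ = r * p + a)
    (hν : ν = (r + 1) * p + d) (had : a + d + 2 = p) (HV : IsWeylChain k μ eV fV hV v)
    (HW : IsWeylChain k ν eW fW hW w) (hQ : IsExtension μ d eV fV eW fW v w e f)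
    (RV : RestrictedOperators k p eV fV hV) (RW : RestrictedOperators k p eW fW hW) :
    RestrictedOperators k p e f (hV.prodMap hW) := by
  have hp0 : (p : k) = 0 := CharP.cast_eq_zero k p
  have hνk : (ν : k) = d := by rw [hν]; push_cast; rw [hp0]; ring
  have hμk : (μ : k) + d + 2 = 0 := by
    have hadk : (a : k) + d + 2 = 0 := by rw [← hp0, ← had]; push_cast; ring
    rw [hμ]; push_cast; linear_combination r * hp0 + hadk
  have hef := commutator_e_f HV HW hQ hνk RV.ef RW.ef
  have hhe := commutator_h_e HV HW hQ hνk hμk RV.he RW.he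
  refine ⟨hef, hhe, commutator_h_f HV HW hQ hνk hμk RV.hf RW.hf,
    e_pow_char hμ hν had HV HW hQ RW.e_pow (pow_char_commute hp hef hhe),
    f_pow_char hp hμ hν had HV HW hQ RW.f_pow, ?_⟩
  have hpow : ∀ n, (hV.prodMap hW) ^ n = (hV ^ n).prodMap (hW ^ n) := by
    intro n
    induction n with
    | zero => rfl
    | succ n ih => rw [pow_succ, ih, LinearMap.prodMap_mul, pow_succ, pow_succ]
  rw [hpow, RV.h_pow, RW.h_pow]

end IsExtension

theorem IsWeylChain.mem_span_of_h_apply {ν : ℕ} {e f h : Module.End k W} {w : ℕ → W}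
    (HW : IsWeylChain k ν e f h w) {α : k} {x : W} (hx : h x = α • x) :
    x ∈ Submodule.span k (w '' {l | (ν : k) - 2 * l = α}) := by
  set b := Module.Basis.mk HW.linearIndependent HW.span_eq_top.ge with hb
  have hbl : ∀ l : Fin (ν + 1), b l = w l := fun l => by rw [hb, Module.Basis.mk_apply]
  have hsum := b.sum_repr x
  have h0 : ∑ l, (b.repr x l * ((ν : k) - 2 * (l : ℕ) - α)) • b l = 0 := by
    have h1 : h x - α • x = 0 := by rw [hx, sub_self]
    rw [← h1]
    conv_rhs => rw [← hsum]
    rw [map_sum, Finset.smul_sum, ← Finset.sum_sub_distrib]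
    refine Finset.sum_congr rfl fun l _ => ?_
    rw [map_smul, hbl, HW.h_apply]
    module
  have h2 := Fintype.linearIndependent_iff.1 b.linearIndependent _ h0
  rw [← hsum]
  refine Submodule.sum_mem _ fun l _ => ?_
  rcases mul_eq_zero.1 (h2 l) with h3 | h3
  · rw [h3, zero_smul]; exact Submodule.zero_mem _
  · rw [hbl]
    exact Submodule.smul_mem _ _ (Submodule.subset_span ⟨l, sub_eq_zero.1 h3, rfl⟩)

namespace IsExtension

variable {p r a d μ ν : ℕ} {eV fV hV : Module.End k V} {eW fW hW : Module.End k W}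
  {v : ℕ → V} {w : ℕ → W} {e f : Module.End k (V × W)}

theorem f_e_inl_mul_char [CharP k p] (hμ : μ = r * p + a)
    (HV : IsWeylChain k μ eV fV hV v) (HW : IsWeylChain k ν eW fW hW w)
    (hQ : IsExtension μ d eV fV eW fW v w e f) {j : ℕ} (hj : j ≤ r) :
    f (e (v (j * p), 0)) = (0, ((d + 1).factorial : k) • w (j * p + d + 1)) := by
  have hle : j * p ≤ μ := by rw [hμ]; exact (Nat.mul_le_mul_right p hj).trans (Nat.le_add_right _ _)
  have h1 : fV (eV (v (j * p))) = 0 ∧ f (eV (v (j * p)), 0) = 0 := by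
    rcases h : j * p with _ | i
    · rw [HV.e_zero, map_zero, hQ.f_inr, map_zero]; exact ⟨rfl, rfl⟩
    · have h0 : (i : k) + 1 = 0 := by
        rw [← Nat.cast_succ, Nat.succ_eq_add_one, ← h]; simp
      rw [HV.e_succ, map_smul, HV.f_apply, h0, prodMk_smul_apply, hQ.f_inl_of_lt HV (by omega), h0,
        hQ.f_inr]
      simp
  rw [hQ.e_inl _ hle, ← add_zero (eV _), ← zero_add (_ • w _), ← Prod.mk_add_mk, map_add, h1.2,
    hQ.f_inr, map_smul, HW.f_apply, ascCoeff_mul_char, smul_smul, zero_add, Nat.factorial_succ]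
  congr 2
  push_cast
  simp; ring

theorem natCast_eq_or_char_two [CharP k p] {l : ℕ} (hν : ν = (r + 1) * p + d)
    (had : a + d + 2 = p) (hl : (ν : k) - 2 * l = a) :
    (l : k) = d + 1 ∨ p ∣ 2 := by
  have hp0 : (p : k) = 0 := CharP.cast_eq_zero k p
  have hνk : (ν : k) = d := by rw [hν]; push_cast; rw [hp0]; ring
  have hadk : (a : k) + d + 2 = 0 := by rw [← hp0, ← had]; push_cast; ring
  have h1 : (2 : k) * (l - (d + 1)) = 0 := by rw [hνk] at hl; linear_combination -hadk - hl
  rcases mul_eq_zero.1 h1 with h2 | h2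
  · right
    rw [← CharP.cast_eq_zero_iff k p]
    exact_mod_cast h2
  · left; exact sub_eq_zero.1 h2

theorem f_e_apply_eq_zero [CharP k p] (hp : p.Prime) (hν : ν = (r + 1) * p + d)
    (had : a + d + 2 = p) (HW : IsWeylChain k ν eW fW hW w) {ω : W}
    (hω : hW ω = (a : k) • ω) : fW (eW ω) = 0 := by
  have hνk : (ν : k) = d := by rw [hν]; simp
  have h1 := HW.mem_span_of_h_apply hω
  suffices h : Submodule.span k (w '' {l | (ν : k) - 2 * l = a}) ≤ LinearMap.ker (fW * eW) from h h1
  rw [Submodule.span_le]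
  rintro _ ⟨l, hl, rfl⟩
  change fW (eW (w l)) = 0
  rcases l with _ | l
  · rw [HW.e_zero, map_zero]
  rw [HW.e_succ, map_smul, HW.f_apply, smul_smul, hνk]
  convert zero_smul k _ using 2
  rcases natCast_eq_or_char_two hν had hl with h2 | h2
  · push_cast at h2; linear_combination (-(l : k) - 1) * h2
  · have hp2 : p = 2 := (Nat.prime_dvd_prime_iff_eq hp Nat.prime_two).1 h2
    obtain ⟨rfl, rfl⟩ : a = 0 ∧ d = 0 := by omega
    have h3 : ((l * (l + 1) : ℕ) : k) = 0 := by
      rw [CharP.cast_eq_zero_iff k p, hp2]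
      exact (Nat.even_mul_succ_self l).two_dvd
    push_cast at h3 ⊢
    linear_combination -h3

theorem mem_of_congr [CharP k p] (hν : ν = (r + 1) * p + d)
    (had : a + d + 2 = p) (HW : IsWeylChain k ν eW fW hW w) {S : Submodule k W}
    (hS : ∀ j ≤ r, w (j * p + d + 1) ∈ S) {l : ℕ} (hl : (l : k) = d + 1) : w l ∈ S := by
  by_cases hlν : l ≤ ν
  · have h1 : ((l : ℕ) : k) = ((d + 1 : ℕ) : k) := by push_cast; exact hl
    rw [CharP.cast_eq_iff_mod_eq k p] at h1
    rw [Nat.mod_eq_of_lt (a := d + 1) (by omega)] at h1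
    have h2 := Nat.div_add_mod' l p
    rw [h1, ← add_assoc] at h2
    rw [← h2]
    refine hS _ ?_
    by_contra! hlt
    have := Nat.mul_le_mul_right p hlt
    rw [Nat.succ_eq_add_one] at this
    omega
  · rw [HW.eq_zero l (not_le.1 hlν)]; exact S.zero_mem

theorem e_f_mem [CharP k p] (hp : p.Prime) (hν : ν = (r + 1) * p + d)
    (had : a + d + 2 = p) (HW : IsWeylChain k ν eW fW hW w) {S : Submodule k W}
    (hSe : ∀ y ∈ S, eW y ∈ S) (hSf : ∀ y ∈ S, fW y ∈ S)
    (hS : ∀ j ≤ r, w (j * p + d + 1) ∈ S) {ω : W} (hω : hW ω = (a : k) • ω) :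
    eW ω ∈ S ∧ fW ω ∈ S := by
  have hp0 : (p : k) = 0 := CharP.cast_eq_zero k p
  have hνk : (ν : k) = d := by rw [hν]; push_cast; rw [hp0]; ring
  have h1 := HW.mem_span_of_h_apply hω
  suffices h : Submodule.span k (w '' {l | (ν : k) - 2 * l = a}) ≤ S.comap eW ⊓ S.comap fW from h h1
  rw [Submodule.span_le]
  rintro _ ⟨l, hl, rfl⟩
  change eW (w l) ∈ S ∧ fW (w l) ∈ S
  rcases natCast_eq_or_char_two hν had hl with h2 | h2
  · have := mem_of_congr hν had HW hS h2
    exact ⟨hSe _ this, hSf _ this⟩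
  · have hp2 : p = 2 := (Nat.prime_dvd_prime_iff_eq hp Nat.prime_two).1 h2
    obtain ⟨rfl, rfl⟩ : a = 0 ∧ d = 0 := by omega
    have hcases : ∀ n : ℕ, (n : k) = 0 ∨ (n : k) = 1 := by
      intro n
      rcases Nat.even_or_odd' n with ⟨m, rfl | rfl⟩
      · left; push_cast; rw [← Nat.cast_two, ← hp2, hp0, zero_mul]
      · right; push_cast; rw [← Nat.cast_two, ← hp2, hp0, zero_mul, zero_add]
    have hmem : ∀ n : ℕ, (n : k) = 1 → w n ∈ S := fun n hn =>
      mem_of_congr hν had HW hS (by rw [hn]; simp)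
    constructor
    · rcases l with _ | l
      · rw [HW.e_zero]; exact S.zero_mem
      · rw [HW.e_succ, hνk]
        rcases hcases l with h3 | h3
        · rw [h3]; simp
        · exact S.smul_mem _ (hmem l h3)
    · rw [HW.f_apply]
      rcases hcases (l + 1) with h3 | h3
      · push_cast at h3; rw [h3, zero_smul]; exact S.zero_mem
      · exact S.smul_mem _ (hmem _ h3)

end IsExtension

/-- A stable subspace of the extension containing lifts of the generators of `V` is everything. -/
theorem IsExtension.eq_top {p r a d μ ν : ℕ} [CharP k p] (hp : p.Prime)
    {eV fV hV : Module.End k V} {eW fW hW : Module.End k W} {v : ℕ → V} {w : ℕ → W}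
    {e f : Module.End k (V × W)} (hμ : μ = r * p + a) (hν : ν = (r + 1) * p + d)
    (had : a + d + 2 = p) (HV : IsWeylChain k μ eV fV hV v) (HW : IsWeylChain k ν eW fW hW w)
    (hQ : IsExtension μ d eV fV eW fW v w e f) {T : Submodule k (V × W)}
    (hTe : ∀ q ∈ T, e q ∈ T) (hTf : ∀ q ∈ T, f q ∈ T)
    (hT : ∀ j ≤ r, ∃ ω, hW ω = (a : k) • ω ∧ (v (j * p), ω) ∈ T) : T = ⊤ := by
  have hp0 : (p : k) = 0 := CharP.cast_eq_zero k p
  have hμk : (μ : k) = a := by rw [hμ]; simp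
  have hνk : (ν : k) = d := by rw [hν]; simp
  have hjle : ∀ j ≤ r, j * p ≤ r * p := fun j hj => Nat.mul_le_mul_right p hj
  set S : Submodule k W := T.comap (LinearMap.inr k V W) with hS
  have hmemS : ∀ y, y ∈ S ↔ ((0 : V), y) ∈ T := fun y => Iff.rfl
  have hSe : ∀ y ∈ S, eW y ∈ S := fun y hy => by
    rw [hmemS, ← hQ.e_inr]; exact hTe _ hy
  have hSf : ∀ y ∈ S, fW y ∈ S := fun y hy => by
    rw [hmemS, ← hQ.f_inr]; exact hTf _ hy
  have hSup : ∀ l : ℕ, (l : k) + 1 ≠ 0 → w l ∈ S → w (l + 1) ∈ S := fun l hl h => by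
    have := hSf _ h
    rw [HW.f_apply] at this
    exact (S.smul_mem_iff hl).1 this
  have hSdown : ∀ l : ℕ, (d : k) - l ≠ 0 → w (l + 1) ∈ S → w l ∈ S := fun l hl h => by
    have := hSe _ h
    rw [HW.e_succ, hνk] at this
    exact (S.smul_mem_iff hl).1 this
  have hfac : ∀ n < p, (n.factorial : k) ≠ 0 := fun n hn => by
    rw [Ne, CharP.cast_eq_zero_iff k p, hp.dvd_factorial]; omega
  -- the weights congruent to `d + 1`
  have hmid : ∀ j ≤ r, w (j * p + d + 1) ∈ S := by
    intro j hj
    obtain ⟨ω, hω, hmem⟩ := hT j hj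
    have h1 := hTf _ (hTe _ hmem)
    rw [map_prodMk e, map_add, f_e_inl_mul_char hμ HV HW hQ hj, hQ.e_inr, hQ.f_inr,
      f_e_apply_eq_zero hp hν had HW hω, Prod.mk_add_mk, add_zero, add_zero] at h1
    exact (S.smul_mem_iff (hfac (d + 1) (by omega))).1 h1
  have hhigh : ∀ j ≤ r, ∀ i ≤ a, w (j * p + d + 1 + i) ∈ S := by
    intro j hj i
    induction i with
    | zero => intro _; exact hmid j hj
    | succ i ih =>
      intro hi
      refine hSup (j * p + d + 1 + i) ?_ (ih (by omega))
      have h1 := natCast_ne_zero_of_lt (k := k) (p := p) (n := d + 2 + i) (by omega) (by omega)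
      push_cast at h1 ⊢
      rw [hp0]
      convert h1 using 1
      ring
  have hω_mem : ∀ ω, hW ω = (a : k) • ω → eW ω ∈ S ∧ fW ω ∈ S := fun ω hω =>
    e_f_mem hp hν had HW hSe hSf hmid hω
  -- the vectors of `V`
  have hlift : ∀ j ≤ r, ∀ i < p, j * p + i ≤ μ →
      ∃ y, fW y ∈ S ∧ (v (j * p + i), y) ∈ T ∧ (i ≠ 0 → y = 0) := by
    intro j hj i
    induction i with
    | zero =>
      intro _ _
      obtain ⟨ω, hω, hmem⟩ := hT j hj
      exact ⟨ω, (hω_mem ω hω).2, hmem, fun h => absurd rfl h⟩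
    | succ i ih =>
      intro hi hle
      obtain ⟨y, hy, hmem, -⟩ := ih (by omega) (by omega)
      refine ⟨0, by rw [map_zero]; exact S.zero_mem, ?_, fun _ => rfl⟩
      have h1 := hTf _ hmem
      rw [map_prodMk, hQ.f_inl_of_lt HV (by omega), hQ.f_inr] at h1
      have h2 := (T.add_mem_iff_left ((hmemS _).1 hy)).1 h1
      refine (T.smul_mem_iff ?_).1 h2
      have h3 := natCast_ne_zero_of_lt (k := k) (p := p) (n := i + 1) (by omega) (by omega)
      push_cast at h3 ⊢
      rwa [hp0, mul_zero, zero_add]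
  -- the weights congruent to `0, …, d`
  have hd : ∀ j ≤ r, w (j * p + d) ∈ S := by
    intro j hj
    obtain ⟨ω, hω, hmem⟩ := hT j hj
    have h1 := hTe _ hmem
    refine (S.smul_mem_iff (hfac d (by omega))).1 ((hmemS _).2 ?_)
    rcases j with _ | j
    · rw [map_prodMk, zero_mul, hQ.e_inl_zero HV, hQ.e_inr] at h1
      have h2 := (T.add_mem_iff_left ((hmemS _).1 (hω_mem ω hω).1)).1 h1
      have h3 := ascCoeff_mul_char (k := k) (p := p) d 0
      rw [zero_mul] at h3
      rw [h3] at h2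
      rwa [zero_mul, zero_add]
    · have hle := hjle _ hj
      rw [Nat.succ_mul] at hle
      have hp2 := hp.two_le
      obtain ⟨y, -, hy, hy0⟩ := hlift j (by omega) (p - 1) (by omega) (by omega)
      obtain rfl := hy0 (by omega)
      have hidx : (j + 1) * p = j * p + (p - 1) + 1 := by rw [Nat.succ_mul]; omega
      rw [map_prodMk, hQ.e_inr, hQ.e_inl _ (hjle _ hj |>.trans (by omega)), ascCoeff_mul_char] at h1
      have h2 := (T.add_mem_iff_left ((hmemS _).1 (hω_mem ω hω).1)).1 h1
      have h4 : eV (v ((j + 1) * p)) = ((μ : k) - (j * p + (p - 1) : ℕ)) • v (j * p + (p - 1)) := by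
        rw [hidx, HV.e_succ]
      rw [h4] at h2
      have h3 := T.sub_mem h2 (T.smul_mem ((μ : k) - (j * p + (p - 1) : ℕ)) hy)
      simpa using h3
  have hlow : ∀ j ≤ r, ∀ i t, i + t = d → w (j * p + i) ∈ S := by
    intro j hj i t
    induction t generalizing i with
    | zero =>
      intro hi
      obtain rfl : i = d := by omega
      exact hd j hj
    | succ t ih =>
      intro hi
      refine hSdown _ ?_ (ih (i + 1) (by omega))
      have h1 := natCast_ne_zero_of_lt (k := k) (p := p) (n := t + 1) (by omega) (by omega)
      rw [← hi]
      push_cast at h1 ⊢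
      rw [hp0]
      convert h1 using 1
      ring
  have htop : ∀ i ≤ d, w ((r + 1) * p + i) ∈ S := by
    intro i
    induction i with
    | zero =>
      intro _
      obtain ⟨y, hy, hmem, -⟩ := hlift r le_rfl a (by omega) hμ.ge
      have h1 := hTf _ hmem
      rw [← hμ, map_prodMk, hQ.f_inl_top, hQ.f_inr] at h1
      have h2 := (T.add_mem_iff_left ((hmemS _).1 hy)).1 h1
      have h3 := S.neg_mem ((hmemS _).2 h2)
      rw [neg_neg] at h3
      have h4 := (S.smul_mem_iff (ascCoeff_ne_zero (k := k) hp (d := d) (i := μ + 1) (j := r)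
        (by omega) (by omega))).1 h3
      rwa [show μ + d + 2 = (r + 1) * p + 0 by rw [Nat.succ_mul]; omega] at h4
    | succ i ih =>
      intro hi
      refine hSup ((r + 1) * p + i) ?_ (ih (by omega))
      have h1 := natCast_ne_zero_of_lt (k := k) (p := p) (n := i + 1) (by omega) (by omega)
      push_cast at h1 ⊢
      rwa [hp0, mul_zero, zero_add]
  have hSall : S = ⊤ := by
    refine HW.eq_top fun l hl => ?_
    have h1 := Nat.div_add_mod' l p
    have h2 := Nat.mod_lt l hp.pos
    rw [← h1]
    by_cases hj : l / p ≤ r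
    · by_cases hi : l % p ≤ d
      · exact hlow _ hj _ _ (Nat.add_sub_cancel' hi)
      · have := hhigh _ hj (l % p - (d + 1)) (by omega)
        rwa [show l / p * p + d + 1 + (l % p - (d + 1)) = l / p * p + l % p by omega] at this
    · have h3 := Nat.mul_le_mul_right p (Nat.lt_of_not_le hj)
      rw [Nat.succ_eq_add_one] at h3
      have := htop (l - (r + 1) * p) (by omega)
      rwa [Nat.add_sub_cancel' (by omega), ← h1] at this
  have hVall : T.comap (LinearMap.inl k V W) = ⊤ := by
    refine HV.eq_top fun i hi => ?_
    have h1 := Nat.div_add_mod' i p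
    have h2 := Nat.mod_lt i hp.pos
    have h3 : i / p ≤ r := by
      by_contra! hlt
      have := Nat.mul_le_mul_right p hlt
      rw [Nat.succ_mul] at this
      omega
    obtain ⟨y, -, hmem, -⟩ := hlift (i / p) h3 (i % p) h2 (by omega)
    rw [h1] at hmem
    have hy : y ∈ S := hSall ▸ Submodule.mem_top
    have := T.sub_mem hmem ((hmemS _).1 hy)
    simpa using this
  rw [eq_top_iff]
  rintro ⟨x, y⟩ -
  have hx : x ∈ T.comap (LinearMap.inl k V W) := hVall ▸ Submodule.mem_top
  have hy : y ∈ S := hSall ▸ Submodule.mem_top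
  have := T.add_mem hx hy
  simpa using this

end Extension

section HellerShift

attribute [local instance] LieRing.ofAssociativeRing

theorem IsRestricted.restrictedOperators {p : ℕ} [CharP k p] (hp : p.Prime) {E F H : sl2 k}
    (hE : (E : Matrix (Fin 2) (Fin 2) k) = !![0, 1; 0, 0])
    (hF : (F : Matrix (Fin 2) (Fin 2) k) = !![0, 0; 1, 0])
    (hH : (H : Matrix (Fin 2) (Fin 2) k) = !![1, 0; 0, -1])
    {M : Type} [AddCommGroup M] [Module k M] [LieRingModule (sl2 k) M] [LieModule k (sl2 k) M]
    (hM : IsRestricted k p M) :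
    RestrictedOperators k p (LieModule.toEnd k (sl2 k) M E) (LieModule.toEnd k (sl2 k) M F)
      (LieModule.toEnd k (sl2 k) M H) := by
  have hlie : ∀ x y : sl2 k, ((⁅x, y⁆ : sl2 k) : Matrix (Fin 2) (Fin 2) k) =
      (x : Matrix (Fin 2) (Fin 2) k) * y - (y : Matrix (Fin 2) (Fin 2) k) * x := fun _ _ => rfl
  have hend : ∀ x y : sl2 k, LieModule.toEnd k (sl2 k) M x * LieModule.toEnd k (sl2 k) M y -
      LieModule.toEnd k (sl2 k) M y * LieModule.toEnd k (sl2 k) M x =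
      LieModule.toEnd k (sl2 k) M ⁅x, y⁆ := fun x y => by
    rw [LieHom.map_lie]; rfl
  have hEF : ⁅E, F⁆ = H := by
    apply Subtype.ext
    rw [hlie, hE, hF, hH]
    ext i j; fin_cases i <;> fin_cases j <;> simp
  have hHE : ⁅H, E⁆ = (2 : k) • E := by
    apply Subtype.ext
    change _ = (2 : k) • (E : Matrix (Fin 2) (Fin 2) k)
    rw [hlie, hE, hH]
    ext i j; fin_cases i <;> fin_cases j <;> simp
    norm_num
  have hHF : ⁅H, F⁆ = -((2 : k) • F) := by
    apply Subtype.ext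
    change _ = -((2 : k) • (F : Matrix (Fin 2) (Fin 2) k))
    rw [hlie, hF, hH]
    ext i j; fin_cases i <;> fin_cases j <;> simp
    norm_num
  obtain ⟨hEp, hFp, hHp⟩ := sl2_basis_pow k hp hE hF hH
  refine ⟨by rw [hend, hEF], by rw [hend, hHE, map_smul], by rw [hend, hHF, map_neg, map_smul],
    ?_, ?_, hM H H hHp⟩
  · rw [hM E 0 hEp, map_zero]
  · rw [hM F 0 hFp, map_zero]

theorem IsWeyl.exists_isWeylChain {μ : ℕ} {V : Type} [AddCommGroup V] [Module k V]
    [LieRingModule (sl2 k) V] [LieModule k (sl2 k) V] {E F H : sl2 k}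
    (hV : IsWeyl k μ V E F H) :
    ∃ v : ℕ → V, IsWeylChain k μ (LieModule.toEnd k (sl2 k) V E) (LieModule.toEnd k (sl2 k) V F)
      (LieModule.toEnd k (sl2 k) V H) v := by
  obtain ⟨v, h1, h2, h3, h4, h5, h6, h7⟩ := hV
  refine ⟨v, h1, h2, h3, h4, fun i => ?_, fun i => ?_, fun i => ?_⟩
  · rw [LieModule.toEnd_apply_apply, h5, ← Int.cast_smul_eq_zsmul k]; simp
  · rw [LieModule.toEnd_apply_apply, h6, ← Int.cast_smul_eq_zsmul k]; simp
  · rw [LieModule.toEnd_apply_apply, h7, ← Int.cast_smul_eq_zsmul k]; simp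

/-- A submodule stable under the standard basis of `sl₂`, as a Lie submodule. -/
theorem exists_lieSubmodule {E F H : sl2 k}
    (hE : (E : Matrix (Fin 2) (Fin 2) k) = !![0, 1; 0, 0])
    (hF : (F : Matrix (Fin 2) (Fin 2) k) = !![0, 0; 1, 0])
    (hH : (H : Matrix (Fin 2) (Fin 2) k) = !![1, 0; 0, -1])
    {M : Type} [AddCommGroup M] [Module k M] [LieRingModule (sl2 k) M] [LieModule k (sl2 k) M]
    (U : Submodule k M) (hUE : ∀ y ∈ U, ⁅E, y⁆ ∈ U) (hUF : ∀ y ∈ U, ⁅F, y⁆ ∈ U)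
    (hUH : ∀ y ∈ U, ⁅H, y⁆ ∈ U) : ∃ N : LieSubmodule k (sl2 k) M, (N : Submodule k M) = U := by
  refine ⟨{ U with lie_mem := fun {x y} hy => ?_ }, rfl⟩
  change ⁅x, y⁆ ∈ U
  rw [sl2_eq_combination k hE hF hH x]
  simp only [add_lie, smul_lie]
  exact U.add_mem (U.add_mem (U.smul_mem _ (hUE y hy)) (U.smul_mem _ (hUF y hy)))
    (U.smul_mem _ (hUH y hy))

section Cover

variable {k}
variable {p r a d : ℕ} {E F H : sl2 k} {V P : Type} [AddCommGroup V] [Module k V]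
  [LieRingModule (sl2 k) V] [LieModule k (sl2 k) V] [AddCommGroup P] [Module k P]
  [LieRingModule (sl2 k) P] [LieModule k (sl2 k) P] {v : ℕ → V}

/-- Elements of `P` lifting the generators of the Weyl module `V(rp + a)`. -/
theorem exists_lift_generators [CharP k p] (hp : p.Prime)
    (hE : (E : Matrix (Fin 2) (Fin 2) k) = !![0, 1; 0, 0])
    (hF : (F : Matrix (Fin 2) (Fin 2) k) = !![0, 0; 1, 0])
    (hH : (H : Matrix (Fin 2) (Fin 2) k) = !![1, 0; 0, -1])
    (had : a + d + 2 = p) (hPres : IsRestricted k p P)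
    (HV : IsWeylChain k (r * p + a) (LieModule.toEnd k (sl2 k) V E) (LieModule.toEnd k (sl2 k) V F)
      (LieModule.toEnd k (sl2 k) V H) v)
    (π : P →ₗ⁅k,sl2 k⁆ V) (hπ : Function.Surjective π) :
    ∃ x : ℕ → P, ∀ j, π (x j) = v (j * p) ∧ ⁅H, x j⁆ = (a : k) • x j ∧ ⁅E, ⁅F, ⁅E, x j⁆⁆⁆ = 0 := by
  have hlift : ∀ j, ∃ x : P, π x = v (j * p) ∧ ⁅H, x⁆ = (a : k) • x ∧ ⁅E, ⁅F, ⁅E, x⁆⁆⁆ = 0 := by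
    intro j
    refine (hPres.restrictedOperators k hp hE hF hH).exists_lift_weight_vector hp (c := d + 1)
      (e' := LieModule.toEnd k (sl2 k) V E) (f' := LieModule.toEnd k (sl2 k) V F)
      (h' := LieModule.toEnd k (sl2 k) V H)
      (by omega) (by omega) (π : P →ₗ[k] V) hπ (fun x => π.map_lie E x) (fun x => π.map_lie F x)
      (fun x => π.map_lie H x) ?_ ?_
    · rw [HV.h_apply]; simp
    · rcases h : j * p with _ | i
      · rw [HV.e_zero, map_zero]
      · have h0 : (i : k) + 1 = 0 := by
          rw [← Nat.cast_succ, Nat.succ_eq_add_one, ← h]; simp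
        rw [HV.e_succ, map_smul, HV.f_apply, h0, zero_smul, smul_zero]
  choose x hx using hlift
  exact ⟨x, hx⟩

theorem finite_and_finrank_le_of_cover [CharP k p] (hp : p.Prime)
    (hE : (E : Matrix (Fin 2) (Fin 2) k) = !![0, 1; 0, 0])
    (hF : (F : Matrix (Fin 2) (Fin 2) k) = !![0, 0; 1, 0])
    (hH : (H : Matrix (Fin 2) (Fin 2) k) = !![1, 0; 0, -1])
    (had : a + d + 2 = p) (hPres : IsRestricted k p P)
    (HV : IsWeylChain k (r * p + a) (LieModule.toEnd k (sl2 k) V E) (LieModule.toEnd k (sl2 k) V F)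
      (LieModule.toEnd k (sl2 k) V H) v)
    (π : P →ₗ⁅k,sl2 k⁆ V) (hcover : ∀ N : LieSubmodule k (sl2 k) P, N ⊔ π.ker = ⊤ → N = ⊤)
    {x : ℕ → P} (hx : ∀ j, π (x j) = v (j * p) ∧ ⁅H, x j⁆ = (a : k) • x j ∧
      ⁅E, ⁅F, ⁅E, x j⁆⁆⁆ = 0) :
    Module.Finite k P ∧ Module.finrank k P ≤ 2 * (r + 1) * p := by
  have R := hPres.restrictedOperators k hp hE hF hH
  set e := LieModule.toEnd k (sl2 k) P E with he
  set f := LieModule.toEnd k (sl2 k) P F with hf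
  let b : Fin (r + 1) × (Fin p ⊕ Fin (d + 1) ⊕ Fin (a + 1)) → P := fun t =>
    RestrictedOperators.spanningFamily p a (d + 1) e f (x t.1) t.2
  set U := Submodule.span k (Set.range b) with hU
  have hUef : ∀ y ∈ U, e y ∈ U ∧ f y ∈ U := by
    intro y hy
    suffices h : U ≤ U.comap e ⊓ U.comap f from h hy
    rw [hU, Submodule.span_le]
    rintro _ ⟨⟨j, t⟩, rfl⟩
    have hle : Submodule.span k (Set.range (RestrictedOperators.spanningFamily p a (d + 1) e f
        (x j))) ≤ U := by
      rw [Submodule.span_le]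
      rintro _ ⟨t, rfl⟩
      exact Submodule.subset_span ⟨(j, t), rfl⟩
    have := R.span_spanningFamily_stable hp (a := a) (c := d + 1) (by omega) (by omega)
      (hx j).2.1 (hx j).2.2 (Submodule.subset_span ⟨t, rfl⟩)
    exact ⟨hle this.1, hle this.2⟩
  have hUH : ∀ y ∈ U, ⁅H, y⁆ ∈ U := by
    intro y hy
    change LieModule.toEnd k (sl2 k) P H y ∈ U
    rw [← R.ef]
    exact U.sub_mem (hUef _ (hUef y hy).2).1 (hUef _ (hUef y hy).1).2
  obtain ⟨N, hN⟩ := exists_lieSubmodule k hE hF hH U (fun y hy => (hUef y hy).1)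
    (fun y hy => (hUef y hy).2) hUH
  have hmap : U.map (π : P →ₗ[k] V) = ⊤ := by
    have hstable : ∀ y ∈ U.map (π : P →ₗ[k] V), LieModule.toEnd k (sl2 k) V F y ∈
        U.map (π : P →ₗ[k] V) := by
      rintro _ ⟨y, hy, rfl⟩
      exact ⟨f y, (hUef y hy).2, π.map_lie F y⟩
    have hblock : ∀ j ≤ r, ∀ i < p, v (j * p + i) ∈ U.map (π : P →ₗ[k] V) := by
      intro j hj i
      induction i with
      | zero =>
        intro _
        exact ⟨x j, Submodule.subset_span ⟨(⟨j, by omega⟩, Sum.inl ⟨0, hp.pos⟩), rfl⟩, (hx j).1⟩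
      | succ i ih =>
        intro hi
        have h1 := hstable _ (ih (by omega))
        rw [HV.f_apply] at h1
        refine (Submodule.smul_mem_iff _ ?_).1 h1
        have h3 := natCast_ne_zero_of_lt (k := k) (p := p) (n := i + 1) (by omega) (by omega)
        push_cast at h3 ⊢
        rwa [CharP.cast_eq_zero k p, mul_zero, zero_add]
    refine HV.eq_top fun i hi => ?_
    have h1 := Nat.div_add_mod' i p
    rw [← h1]
    refine hblock _ ?_ _ (Nat.mod_lt i hp.pos)
    by_contra! hlt
    have := Nat.mul_le_mul_right p hlt
    rw [Nat.succ_mul] at this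
    omega
  have hNtop : N = ⊤ := by
    refine hcover N ?_
    rw [eq_top_iff]
    intro y _
    obtain ⟨z, hz, hzy⟩ : π y ∈ U.map (π : P →ₗ[k] V) := hmap ▸ Submodule.mem_top
    refine (LieSubmodule.mem_sup _ _ _).2 ⟨z, ?_, y - z, ?_, by abel⟩
    · rw [← LieSubmodule.mem_toSubmodule, hN]; exact hz
    · rw [LieModuleHom.mem_ker, map_sub, sub_eq_zero]; exact hzy.symm
  have hUtop : U = ⊤ := by rw [← hN, hNtop, LieSubmodule.top_toSubmodule]
  refine ⟨⟨⟨(Set.finite_range b).toFinset, by simpa using hUtop⟩⟩, ?_⟩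
  refine (finrank_le_of_span_eq_top hUtop).trans (le_of_eq ?_)
  simp only [Fintype.card_prod, Fintype.card_sum, Fintype.card_fin]
  rw [show p + (d + 1 + (a + 1)) = 2 * p by omega]
  ring

/-- The kernel of a projective cover of `V(rp + a)` is `V((r + 1)p + d)`, where `a + d + 2 = p`. -/
theorem nonempty_ker_lieModuleEquiv [CharP k p] (hp : p.Prime)
    (hE : (E : Matrix (Fin 2) (Fin 2) k) = !![0, 1; 0, 0])
    (hF : (F : Matrix (Fin 2) (Fin 2) k) = !![0, 0; 1, 0])
    (hH : (H : Matrix (Fin 2) (Fin 2) k) = !![1, 0; 0, -1])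
    (had : a + d + 2 = p) {W : Type} [AddCommGroup W] [Module k W] [LieRingModule (sl2 k) W]
    [LieModule k (sl2 k) W] (hVres : IsRestricted k p V) (hWres : IsRestricted k p W)
    (hPres : IsRestricted k p P) (hV : IsWeyl k (r * p + a) V E F H)
    (hW : IsWeyl k ((r + 1) * p + d) W E F H) (hPproj : IsRestrictedProjective k p P)
    (π : P →ₗ⁅k,sl2 k⁆ V) (hπ : Function.Surjective π)
    (hcover : ∀ N : LieSubmodule k (sl2 k) P, N ⊔ π.ker = ⊤ → N = ⊤) :
    Nonempty (π.ker ≃ₗ⁅k,sl2 k⁆ W) := by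
  obtain ⟨v, HV⟩ := IsWeyl.exists_isWeylChain k hV
  obtain ⟨w, HW⟩ := IsWeyl.exists_isWeylChain k hW
  have RV := hVres.restrictedOperators k hp hE hF hH
  have RW := hWres.restrictedOperators k hp hE hF hH
  obtain ⟨e, f, hQ⟩ := HV.exists_isExtension (d := d) (w := w)
    (eW := LieModule.toEnd k (sl2 k) W E) (fW := LieModule.toEnd k (sl2 k) W F)
  have RQ := hQ.restrictedOperators hp rfl rfl had HV HW RV RW
  obtain ⟨φ, hφ, hφE, hφF, hφH⟩ := hPproj.exists_lift k hp hE hF hH hVres π RQ.ef RQ.he RQ.hf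
    RQ.e_pow RQ.f_pow RQ.h_pow (LinearMap.fst k V W) LinearMap.fst_surjective
    (fun q => hQ.e_fst q) (fun q => hQ.f_fst q) (fun _ => rfl)
  obtain ⟨x, hx⟩ := exists_lift_generators hp hE hF hH had hPres HV π hπ
  obtain ⟨hfin, hle⟩ := finite_and_finrank_le_of_cover hp hE hF hH had hPres HV π hcover hx
  have := HV.finite
  have := HW.finite
  have hsurj : LinearMap.range φ = ⊤ := by
    refine hQ.eq_top hp rfl rfl had HV HW ?_ ?_ fun j _ => ⟨(φ (x j)).2, ?_, x j, ?_⟩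
    · rintro _ ⟨y, rfl⟩
      exact ⟨⁅E, y⁆, hφE y⟩
    · rintro _ ⟨y, rfl⟩
      exact ⟨⁅F, y⁆, hφF y⟩
    · have := hφH (x j)
      rw [(hx j).2.1, map_smul] at this
      exact (congrArg Prod.snd this).symm
    · exact Prod.ext ((hφ (x j)).trans (hx j).1) rfl
  have hinj : LinearMap.ker φ = ⊥ := by
    have h1 := LinearMap.finrank_range_add_finrank_ker φ
    rw [hsurj, finrank_top, Module.finrank_prod, HV.finrank_eq, HW.finrank_eq] at h1
    have h2 : r * p + a + 1 + ((r + 1) * p + d + 1) = 2 * (r + 1) * p := by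
      rw [← had]; ring
    exact Submodule.finrank_eq_zero.1 (by omega)
  have hfst : ∀ y : π.ker, φ y = (0, (φ y).2) := fun y =>
    Prod.ext ((hφ y).trans (LieModuleHom.mem_ker.1 y.2)) rfl
  let ψ : π.ker →ₗ[k] W := LinearMap.snd k V W ∘ₗ φ ∘ₗ (π.ker : Submodule k P).subtype
  have hψ : Function.Bijective ψ := by
    refine ⟨(injective_iff_map_eq_zero ψ).2 fun y hy => ?_, fun y => ?_⟩
    · refine Subtype.ext (LinearMap.ker_eq_bot'.1 hinj _ ?_)
      rw [hfst]
      exact Prod.ext rfl hy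
    · obtain ⟨z, hz⟩ := LinearMap.range_eq_top.1 hsurj (0, y)
      exact ⟨⟨z, LieModuleHom.mem_ker.2 ((hφ z).symm.trans (congrArg Prod.fst hz))⟩,
        congrArg Prod.snd hz⟩
  have hψE : ∀ y : π.ker, ψ ⁅E, y⁆ = ⁅E, ψ y⁆ := fun y => by
    have := hφE y
    rw [hfst y, hQ.e_inr] at this
    exact congrArg Prod.snd this
  have hψF : ∀ y : π.ker, ψ ⁅F, y⁆ = ⁅F, ψ y⁆ := fun y => by
    have := hφF y
    rw [hfst y, hQ.f_inr] at this
    exact congrArg Prod.snd this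
  have hψH : ∀ y : π.ker, ψ ⁅H, y⁆ = ⁅H, ψ y⁆ := fun y => congrArg Prod.snd (hφH y)
  refine ⟨{ LinearEquiv.ofBijective ψ hψ with map_lie' := fun {t y} => ?_ }⟩
  change ψ ⁅t, y⁆ = ⁅t, ψ y⁆
  rw [sl2_eq_combination k hE hF hH t]
  simp only [add_lie, smul_lie, map_add, map_smul, hψE, hψF, hψH]

end Cover

end HellerShift

/-- `Ω(V(λ)) ≅ V((r+2)p − a − 2)` for `λ = rp + a`, `0 ≤ a < p`, `a ≠ p − 1`: if
`π : P → V(λ)` is a projective cover in the category of restricted `sl₂`-modules, then its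
kernel (the Heller shift `Ω(V(λ))`) is isomorphic to the Weyl module `V((r+2)p − a − 2)`;
in particular it has dimension `(r+2)p − a − 1`. -/
theorem heller_shift_weyl {p : ℕ} [IsAlgClosed k] [CharP k p] (hp : p.Prime)
    (r a : ℕ) (ha : a < p) (hap : a ≠ p - 1)
    (E F H : sl2 k)
    (hE : (E : Matrix (Fin 2) (Fin 2) k) = !![0, 1; 0, 0])
    (hF : (F : Matrix (Fin 2) (Fin 2) k) = !![0, 0; 1, 0])
    (hH : (H : Matrix (Fin 2) (Fin 2) k) = !![1, 0; 0, -1])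
    (V W P : Type) [AddCommGroup V] [Module k V] [LieRingModule (sl2 k) V]
    [LieModule k (sl2 k) V] [AddCommGroup W] [Module k W] [LieRingModule (sl2 k) W]
    [LieModule k (sl2 k) W] [AddCommGroup P] [Module k P] [LieRingModule (sl2 k) P]
    [LieModule k (sl2 k) P]
    (hVres : IsRestricted k p V) (hWres : IsRestricted k p W) (hPres : IsRestricted k p P)
    (hV : IsWeyl k (r * p + a) V E F H)
    (hW : IsWeyl k ((r + 2) * p - a - 2) W E F H)
    (hPproj : IsRestrictedProjective k p P)
    (π : P →ₗ⁅k,sl2 k⁆ V) (hπ : Function.Surjective π)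
    (hcover : ∀ N : LieSubmodule k (sl2 k) P, N ⊔ π.ker = ⊤ → N = ⊤) :
    Nonempty (↥π.ker ≃ₗ⁅k,sl2 k⁆ W) ∧
      Module.finrank k ↥π.ker = (r + 2) * p - a - 1 := by
  have hp2 := hp.two_le
  obtain ⟨d, had⟩ : ∃ d, a + d + 2 = p := ⟨p - a - 2, by omega⟩
  have hmul : (r + 2) * p = (r + 1) * p + p := by ring
  have hν : (r + 2) * p - a - 2 = (r + 1) * p + d := by omega
  rw [hν] at hW
  obtain ⟨ψ⟩ := nonempty_ker_lieModuleEquiv hp hE hF hH had hVres hWres hPres hV hW hPproj π hπ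
    hcover
  obtain ⟨w, HW⟩ := IsWeyl.exists_isWeylChain k hW
  refine ⟨⟨ψ⟩, ?_⟩
  rw [ψ.toLinearEquiv.finrank_eq, HW.finrank_eq]
  omega
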